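/- arXiv:2009.12397 — 2 statements merged into one kernel-verified Lean document; each statement's English description precedes it below -/
import Mathlib

section
/- Let X and Y be complex Banach spaces. Let A be a closed linear relation from X to Y with closed range R(A), let γ > 0 be a lower bound for A, and let B be a closed linear relation from X to Y with D(A) ⊆ D(B), B(0) ⊆ A(0), which is relatively bounded with respect to A with constants σ, τ ≥ 0. Assume ν(A : B) = ∞, i.e. N(A) ⊆ M_n for every n ≥ 0. Then for every λ ∈ ℂ with |λ|·(3σ + τγ) < γ, the relation A − λB has closed range; in fact γ − |λ|·(3σ + τγ) is a lower bound for A − λB. -/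
open Metric Set

section Defs

variable {X Y : Type*} [AddCommGroup X] [Module ℂ X] [AddCommGroup Y] [Module ℂ Y]

/-- The domain `D(A)` of a linear relation (given by its graph). -/
def relDom (A : Submodule ℂ (X × Y)) : Set X := {x | ∃ y, (x, y) ∈ A}

/-- The range `R(A)` of a linear relation. -/
def relRan (A : Submodule ℂ (X × Y)) : Set Y := {y | ∃ x, (x, y) ∈ A}

/-- The null space `N(A)` of a linear relation. -/
def relKer (A : Submodule ℂ (X × Y)) : Set X := {x | (x, (0 : Y)) ∈ A}

/-- The set `A(0)` of a linear relation. -/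
def relMul0 (A : Submodule ℂ (X × Y)) : Set Y := {y | ((0 : X), y) ∈ A}

/-- The linear relation `A - λB`, with graph
`{(x, y - λ • z) : (x, y) ∈ G(A), (x, z) ∈ G(B)}`. -/
def subRel (lam : ℂ) (A B : Submodule ℂ (X × Y)) : Submodule ℂ (X × Y) where
  carrier := {p | ∃ y z, (p.1, y) ∈ A ∧ (p.1, z) ∈ B ∧ p.2 = y - lam • z}
  add_mem' := by
    rintro ⟨x₁, w₁⟩ ⟨x₂, w₂⟩ ⟨y₁, z₁, hA₁, hB₁, rfl⟩ ⟨y₂, z₂, hA₂, hB₂, rfl⟩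
    refine ⟨y₁ + y₂, z₁ + z₂, A.add_mem hA₁ hA₂, B.add_mem hB₁ hB₂, ?_⟩
    show (y₁ - lam • z₁) + (y₂ - lam • z₂) = (y₁ + y₂) - lam • (z₁ + z₂)
    rw [smul_add]; abel
  zero_mem' := ⟨0, 0, A.zero_mem, B.zero_mem, by simp⟩
  smul_mem' := by
    rintro c ⟨x, w⟩ ⟨y, z, hA, hB, rfl⟩
    refine ⟨c • y, c • z, A.smul_mem c hA, B.smul_mem c hB, ?_⟩
    show c • (y - lam • z) = c • y - lam • (c • z)
    rw [smul_sub, smul_comm]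

/-- The image `A(M)` of a set under a linear relation. -/
def relImg (A : Submodule ℂ (X × Y)) (M : Set X) : Set Y := {y | ∃ x ∈ M, (x, y) ∈ A}

/-- The preimage `A⁻¹(S)` of a set under a linear relation. -/
def relPre (A : Submodule ℂ (X × Y)) (S : Set Y) : Set X := {x | ∃ y ∈ S, (x, y) ∈ A}

/-- The sequence `M_n`: `M_0 = X`, `M_n = B⁻¹(A(M_{n-1}))`. -/
def Mseq (A B : Submodule ℂ (X × Y)) : ℕ → Set X
  | 0 => univ
  | n + 1 => relPre B (relImg A (Mseq A B n))

end Defs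

theorem Submodule.infDist_le_infDist_sub_smul_add {Y : Type*} [NormedAddCommGroup Y]
    [NormedSpace ℂ Y] (S : Submodule ℂ Y) (y z : Y) (c : ℂ) :
    infDist y S ≤ infDist (y - c • z) S + ‖c‖ * infDist z S := by
  have norm_mk : ∀ x : Y, ‖(Submodule.Quotient.mk x : Y ⧸ S)‖ = infDist x S := fun x =>
    QuotientAddGroup.norm_mk (S := S.toAddSubgroup) x
  rw [← norm_mk, ← norm_mk, ← norm_mk]
  have h : (Submodule.Quotient.mk y : Y ⧸ S) =
      Submodule.Quotient.mk (y - c • z) + c • Submodule.Quotient.mk z := by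
    rw [← Submodule.Quotient.mk_smul, ← Submodule.Quotient.mk_add, sub_add_cancel]
  rw [h]
  exact (norm_add_le _ _).trans (by gcongr; exact norm_smul_le _ _)

theorem exists_seq_of_step {α : Type*} {P : ℕ → α → Prop} {R : ℕ → α → α → Prop} {a : α}
    (h0 : P 0 a) (hstep : ∀ n p, P n p → ∃ q, P (n + 1) q ∧ R n p q) :
    ∃ s : ℕ → α, s 0 = a ∧ ∀ n, R n (s n) (s (n + 1)) := by
  choose f hP hR using hstep
  let t : (n : ℕ) → {p // P n p} := fun n =>
    Nat.rec ⟨a, h0⟩ (fun n p => ⟨f n p.1 p.2, hP n p.1 p.2⟩) n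
  exact ⟨fun n => (t n).1, rfl, fun n => hR n (t n).1 (t n).2⟩

section LinearRelation

variable {X Y : Type*} [AddCommGroup X] [Module ℂ X] [AddCommGroup Y] [Module ℂ Y]
  {A B : Submodule ℂ (X × Y)}

theorem relMul0_eq_coe (A : Submodule ℂ (X × Y)) :
    relMul0 A = (A.comap (LinearMap.inr ℂ X Y) : Set Y) := rfl

theorem relMul0_nonempty (A : Submodule ℂ (X × Y)) : (relMul0 A).Nonempty := ⟨0, A.zero_mem⟩

theorem relKer_nonempty (A : Submodule ℂ (X × Y)) : (relKer A).Nonempty := ⟨0, A.zero_mem⟩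

theorem sub_mem_of_mem_relKer {x n : X} {y : Y} (h : (x, y) ∈ A) (hn : n ∈ relKer A) :
    (x - n, y) ∈ A := by
  simpa using A.sub_mem h hn

theorem sub_mem_of_mem_relMul0 {x : X} {y k : Y} (h : (x, y) ∈ A) (hk : k ∈ relMul0 A) :
    (x, y - k) ∈ A := by
  simpa using A.sub_mem h hk

theorem relMul0_subRel (h0 : relMul0 B ⊆ relMul0 A) (c : ℂ) :
    relMul0 (subRel c A B) = relMul0 A := by
  ext w
  constructor
  · rintro ⟨y, z, hy, hz, hw⟩
    change w = y - c • z at hw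
    subst hw
    exact ((A.comap (LinearMap.inr ℂ X Y)).sub_mem hy
      ((A.comap (LinearMap.inr ℂ X Y)).smul_mem c (h0 hz)))
  · intro hw
    exact ⟨w, 0, hw, B.zero_mem, by simp⟩

theorem add_mem_Mseq (A B : Submodule ℂ (X × Y)) (n : ℕ) {x x' : X} (hx : x ∈ Mseq A B n)
    (hx' : x' ∈ Mseq A B n) : x + x' ∈ Mseq A B n := by
  induction n generalizing x x' with
  | zero => trivial
  | succ n ih =>
    obtain ⟨y, ⟨u, hu, huy⟩, hxy⟩ := hx
    obtain ⟨y', ⟨u', hu', huy'⟩, hxy'⟩ := hx'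
    exact ⟨y + y', ⟨u + u', ih hu hu', A.add_mem huy huy'⟩, B.add_mem hxy hxy'⟩

theorem mem_Mseq_of_mem_of_mem (h0 : relMul0 B ⊆ relMul0 A)
    (hν : ∀ n, relKer A ⊆ Mseq A B n) {x u : X} {y : Y} (hx : ∀ n, x ∈ Mseq A B n)
    (hxy : (x, y) ∈ B) (huy : (u, y) ∈ A) (n : ℕ) : u ∈ Mseq A B n := by
  obtain ⟨y', ⟨u', hu', huy'⟩, hxy'⟩ := hx (n + 1)
  have hk : (0, y - y') ∈ A := h0 (by simpa [relMul0] using B.sub_mem hxy hxy')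
  have hker : u - u' ∈ relKer A := by
    simpa [relKer] using A.sub_mem (A.sub_mem huy huy') hk
  simpa using add_mem_Mseq A B n hu' (hν n hker)

end LinearRelation

section Normed

variable {X Y : Type*} [NormedAddCommGroup X] [NormedSpace ℂ X]
  [NormedAddCommGroup Y] [NormedSpace ℂ Y] {A B : Submodule ℂ (X × Y)} {γ σ τ : ℝ}

theorem exists_mem_relMul0_norm_sub_lt {y : Y} {r : ℝ} (h : infDist y (relMul0 A) < r) :
    ∃ k ∈ relMul0 A, ‖y - k‖ < r := by
  simpa only [dist_eq_norm] using (infDist_lt_iff (relMul0_nonempty A)).1 h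

theorem exists_mem_relKer_norm_sub_lt {x : X} {r : ℝ} (h : infDist x (relKer A) < r) :
    ∃ n ∈ relKer A, ‖x - n‖ < r := by
  simpa only [dist_eq_norm] using (infDist_lt_iff (relKer_nonempty A)).1 h

theorem infDist_relMul0_le_norm (A : Submodule ℂ (X × Y)) (y : Y) :
    infDist y (relMul0 A) ≤ ‖y‖ := by
  have h : (0 : Y) ∈ relMul0 A := A.zero_mem
  simpa using infDist_le_dist_of_mem (x := y) h

theorem exists_next_of_mem_Mseq (hγ : 0 < γ)
    (hlb : ∀ x y, (x, y) ∈ A → γ * infDist x (relKer A) ≤ infDist y (relMul0 A))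
    (h0 : relMul0 B ⊆ relMul0 A)
    (hrb : ∀ x y, (x, y) ∈ A → ∀ z, (x, z) ∈ B →
      infDist z (relMul0 B) ≤ σ * ‖x‖ + τ * infDist y (relMul0 A))
    (hν : ∀ n : ℕ, relKer A ⊆ Mseq A B n) {x : X} {y : Y} {q : ℝ} (hxy : (x, y) ∈ A)
    (hx : ∀ n, x ∈ Mseq A B n) (hq : σ * ‖x‖ + τ * infDist y (relMul0 A) < q) :
    ∃ x' y', (x', y') ∈ A ∧ (∀ n, x' ∈ Mseq A B n) ∧ (x, y') ∈ B ∧ ‖x'‖ < q / γ ∧ ‖y'‖ < q := by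
  obtain ⟨z, ⟨u, -, huz⟩, hxz⟩ := hx 1
  obtain ⟨k, hk, hkq⟩ := exists_mem_relMul0_norm_sub_lt ((hrb x y hxy z hxz).trans_lt hq)
  have hu := sub_mem_of_mem_relMul0 huz (h0 hk)
  have hdist : infDist u (relKer A) < q / γ := by
    rw [lt_div_iff₀' hγ]
    exact ((hlb _ _ hu).trans (infDist_relMul0_le_norm A _)).trans_lt hkq
  obtain ⟨n, hn, hnq⟩ := exists_mem_relKer_norm_sub_lt hdist
  have hun := sub_mem_of_mem_relKer hu hn
  have hxB := sub_mem_of_mem_relMul0 hxz hk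
  exact ⟨u - n, z - k, hun, mem_Mseq_of_mem_of_mem h0 hν hx hxB hun, hxB, hnq, hkq⟩

theorem infDist_relKer_subRel_le_of_lt [CompleteSpace X] [CompleteSpace Y]
    (hA : IsClosed (A : Set (X × Y))) (hB : IsClosed (B : Set (X × Y))) (hγ : 0 < γ)
    (hlb : ∀ x y, (x, y) ∈ A → γ * infDist x (relKer A) ≤ infDist y (relMul0 A))
    (h0 : relMul0 B ⊆ relMul0 A) (hσ : 0 ≤ σ) (hτ : 0 ≤ τ)
    (hrb : ∀ x y, (x, y) ∈ A → ∀ z, (x, z) ∈ B →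
      infDist z (relMul0 B) ≤ σ * ‖x‖ + τ * infDist y (relMul0 A))
    (hν : ∀ n : ℕ, relKer A ⊆ Mseq A B n) {c : ℂ} {σ' : ℝ} (hσ' : σ < σ')
    (hc : ‖c‖ * (σ' + τ * γ) < γ) {x : X} (hx : x ∈ relKer A) :
    (γ - ‖c‖ * (σ' + τ * γ)) * infDist x (relKer (subRel c A B)) ≤ ‖c‖ * σ' * ‖x‖ := by
  rcases eq_or_ne x 0 with rfl | hx0
  · have h : (0 : X) ∈ relKer (subRel c A B) := (subRel c A B).zero_mem
    simp [infDist_zero_of_mem h]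
  have hxpos : 0 < ‖x‖ := norm_pos_iff.2 hx0
  have hσpos : 0 < σ' := hσ.trans_lt hσ'
  set r := σ' / γ + τ with hr
  have hrpos : 0 < r := by positivity
  set Q : ℕ → ℝ := fun n => r ^ n * (σ' * ‖x‖) with hQ
  have hQpos : ∀ n, 0 < Q n := fun n => by positivity
  obtain ⟨s, hs0, hs⟩ := exists_seq_of_step (α := X × Y)
    (P := fun n p => p ∈ A ∧ (∀ k, p.1 ∈ Mseq A B k) ∧
      σ * ‖p.1‖ + τ * infDist p.2 (relMul0 A) < Q n)
    (R := fun n p q => q ∈ A ∧ (p.1, q.2) ∈ B ∧ ‖q.1‖ ≤ Q n / γ ∧ ‖q.2‖ ≤ Q n)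
    (a := (x, 0)) ⟨hx, fun k => hν k hx, by
      have h : (0 : Y) ∈ relMul0 A := A.zero_mem
      simp only [infDist_zero_of_mem h, hQ, pow_zero, one_mul, mul_zero, add_zero]
      gcongr⟩ (by
    rintro n ⟨u, y⟩ ⟨hu, huM, huQ⟩
    obtain ⟨u', y', h1, h2, h3, h4, h5⟩ :=
      exists_next_of_mem_Mseq hγ hlb h0 hrb hν hu huM huQ
    refine ⟨(u', y'), ⟨h1, h2, ?_⟩, h1, h3, h4.le, h5.le⟩
    calc σ * ‖u'‖ + τ * infDist y' (relMul0 A)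
        ≤ σ * (Q n / γ) + τ * Q n := by
          gcongr
          exact (infDist_relMul0_le_norm A y').trans h5.le
      _ < σ' * (Q n / γ) + τ * Q n := by
          have := hQpos n
          gcongr
      _ = Q (n + 1) := by simp only [hQ, hr, pow_succ]; ring)
  have hcr : ‖c‖ * r < 1 := by
    rw [hr, ← mul_lt_mul_iff_left₀ hγ]
    calc ‖c‖ * (σ' / γ + τ) * γ = ‖c‖ * (σ' + τ * γ) := by field_simp
      _ < 1 * γ := by linarith
  have hgeom := hasSum_geometric_of_lt_one (by positivity : 0 ≤ ‖c‖ * r) hcr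
  have hbx : ∀ n, ‖c ^ (n + 1) • (s (n + 1)).1‖ ≤ ‖c‖ * σ' * ‖x‖ / γ * (‖c‖ * r) ^ n := by
    intro n
    rw [norm_smul, norm_pow]
    calc ‖c‖ ^ (n + 1) * ‖(s (n + 1)).1‖ ≤ ‖c‖ ^ (n + 1) * (Q n / γ) := by
          gcongr
          exact (hs n).2.2.1
      _ = _ := by simp only [hQ, mul_pow, pow_succ]; ring
  have hby : ∀ n, ‖c ^ n • (s (n + 1)).2‖ ≤ σ' * ‖x‖ * (‖c‖ * r) ^ n := by
    intro n
    rw [norm_smul, norm_pow]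
    calc ‖c‖ ^ n * ‖(s (n + 1)).2‖ ≤ ‖c‖ ^ n * Q n := by
          gcongr
          exact (hs n).2.2.2
      _ = _ := by simp only [hQ, mul_pow]; ring
  have hgx := hgeom.mul_left (‖c‖ * σ' * ‖x‖ / γ)
  have hX := (Summable.of_norm_bounded hgx.summable hbx).hasSum
  have hY := (Summable.of_norm_bounded (hgeom.mul_left (σ' * ‖x‖)).summable hby).hasSum
  set v := ∑' n, c ^ (n + 1) • (s (n + 1)).1
  set z := ∑' n, c ^ n • (s (n + 1)).2
  have hvA : (v, c • z) ∈ A := by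
    refine hA.mem_of_tendsto (hX.prodMk (hY.const_smul c)) (.of_forall fun F => ?_)
    refine A.sum_mem fun n _ => ?_
    have h := A.smul_mem (c ^ (n + 1)) (hs n).1
    simpa only [Prod.smul_def, pow_succ', mul_smul] using h
  have hX0 : HasSum (fun n => c ^ n • (s n).1) (x + v) := by
    rw [← hasSum_nat_add_iff' 1]
    simpa [hs0] using hX
  have hvB : (x + v, z) ∈ B := by
    refine hB.mem_of_tendsto (hX0.prodMk hY) (.of_forall fun F => ?_)
    exact B.sum_mem fun n _ => B.smul_mem (c ^ n) (hs n).2.1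
  have hker : x + v ∈ relKer (subRel c A B) :=
    ⟨c • z, z, by simpa using A.add_mem hx hvA, hvB, by simp⟩
  have hnorm : ‖v‖ ≤ ‖c‖ * σ' * ‖x‖ / γ * (1 - ‖c‖ * r)⁻¹ := tsum_of_norm_bounded hgx hbx
  have hdist : infDist x (relKer (subRel c A B)) ≤ ‖v‖ := by
    simpa [dist_eq_norm] using infDist_le_dist_of_mem (x := x) hker
  have hfac : γ - ‖c‖ * (σ' + τ * γ) = γ * (1 - ‖c‖ * r) := by
    rw [hr]; field_simp
  rw [hfac]
  have h1 : 0 < 1 - ‖c‖ * r := by linarith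
  calc γ * (1 - ‖c‖ * r) * infDist x (relKer (subRel c A B))
      ≤ γ * (1 - ‖c‖ * r) * (‖c‖ * σ' * ‖x‖ / γ * (1 - ‖c‖ * r)⁻¹) := by
        gcongr
        exact hdist.trans hnorm
    _ = ‖c‖ * σ' * ‖x‖ := by field_simp

theorem infDist_relKer_subRel_le [CompleteSpace X] [CompleteSpace Y]
    (hA : IsClosed (A : Set (X × Y))) (hB : IsClosed (B : Set (X × Y))) (hγ : 0 < γ)
    (hlb : ∀ x y, (x, y) ∈ A → γ * infDist x (relKer A) ≤ infDist y (relMul0 A))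
    (h0 : relMul0 B ⊆ relMul0 A) (hσ : 0 ≤ σ) (hτ : 0 ≤ τ)
    (hrb : ∀ x y, (x, y) ∈ A → ∀ z, (x, z) ∈ B →
      infDist z (relMul0 B) ≤ σ * ‖x‖ + τ * infDist y (relMul0 A))
    (hν : ∀ n : ℕ, relKer A ⊆ Mseq A B n) {c : ℂ}
    (hc : ‖c‖ * (σ + τ * γ) < γ) {x : X} (hx : x ∈ relKer A) :
    (γ - ‖c‖ * (σ + τ * γ)) * infDist x (relKer (subRel c A B)) ≤ ‖c‖ * σ * ‖x‖ := by
  have hcont : Continuous fun t : ℝ => ‖c‖ * (t + τ * γ) := by fun_prop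
  have hl : Filter.Tendsto
      (fun t : ℝ => (γ - ‖c‖ * (t + τ * γ)) * infDist x (relKer (subRel c A B)))
      (nhdsWithin σ (Ioi σ))
      (nhds ((γ - ‖c‖ * (σ + τ * γ)) * infDist x (relKer (subRel c A B)))) :=
    (Continuous.tendsto (by fun_prop) σ).mono_left nhdsWithin_le_nhds
  have hr : Filter.Tendsto (fun t : ℝ => ‖c‖ * t * ‖x‖) (nhdsWithin σ (Ioi σ))
      (nhds (‖c‖ * σ * ‖x‖)) :=
    (Continuous.tendsto (by fun_prop) σ).mono_left nhdsWithin_le_nhds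
  refine le_of_tendsto_of_tendsto hl hr ?_
  filter_upwards [self_mem_nhdsWithin,
    nhdsWithin_le_nhds (hcont.continuousAt.eventually_lt continuousAt_const hc)] with t ht hct
  exact infDist_relKer_subRel_le_of_lt hA hB hγ hlb h0 hσ hτ hrb hν ht hct hx

theorem one_sub_mul_infDist_relMul0_le (h0 : relMul0 B ⊆ relMul0 A)
    (hrb : ∀ x y, (x, y) ∈ A → ∀ z, (x, z) ∈ B →
      infDist z (relMul0 B) ≤ σ * ‖x‖ + τ * infDist y (relMul0 A))
    (c : ℂ) {x : X} {y z : Y} (hy : (x, y) ∈ A) (hz : (x, z) ∈ B) :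
    (1 - ‖c‖ * τ) * infDist y (relMul0 A) ≤
      infDist (y - c • z) (relMul0 A) + ‖c‖ * σ * ‖x‖ := by
  have h1 := Submodule.infDist_le_infDist_sub_smul_add (A.comap (LinearMap.inr ℂ X Y)) y z c
  rw [← relMul0_eq_coe] at h1
  have h2 := mul_le_mul_of_nonneg_left
    ((infDist_le_infDist_of_subset h0 (relMul0_nonempty B)).trans (hrb x y hy z hz))
    (norm_nonneg c)
  linarith

theorem lower_bound_subRel [CompleteSpace X] [CompleteSpace Y]
    (hA : IsClosed (A : Set (X × Y))) (hB : IsClosed (B : Set (X × Y))) (hγ : 0 < γ)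
    (hlb : ∀ x y, (x, y) ∈ A → γ * infDist x (relKer A) ≤ infDist y (relMul0 A))
    (h0 : relMul0 B ⊆ relMul0 A) (hσ : 0 ≤ σ) (hτ : 0 ≤ τ)
    (hrb : ∀ x y, (x, y) ∈ A → ∀ z, (x, z) ∈ B →
      infDist z (relMul0 B) ≤ σ * ‖x‖ + τ * infDist y (relMul0 A))
    (hν : ∀ n : ℕ, relKer A ⊆ Mseq A B n) {c : ℂ} (hc : ‖c‖ * (σ + τ * γ) < γ)
    {x : X} {w : Y} (hw : (x, w) ∈ subRel c A B) :
    (γ - ‖c‖ * (3 * σ + τ * γ)) * infDist x (relKer (subRel c A B)) ≤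
      infDist w (relMul0 A) := by
  set N := relKer (subRel c A B)
  set D := γ - ‖c‖ * (σ + τ * γ) with hD
  have hDpos : 0 < D := by linarith
  have hcσ : 0 ≤ ‖c‖ * σ := by positivity
  have hcτ : 0 < 1 - ‖c‖ * τ := by
    refine pos_of_mul_pos_left (b := γ) ?_ hγ.le
    nlinarith
  have hgap : ∀ v : X, D * infDist v N - ‖c‖ * σ * ‖v‖ ≤
      (D + ‖c‖ * σ) * infDist v (relKer A) := by
    intro v
    rw [← div_le_iff₀' (by linarith), le_infDist (relKer_nonempty A)]
    intro n hn
    rw [div_le_iff₀' (by linarith), dist_eq_norm]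
    have h1 := infDist_relKer_subRel_le hA hB hγ hlb h0 hσ hτ hrb hν hc hn
    have h2 := mul_le_mul_of_nonneg_left (infDist_le_infDist_add_dist (s := N) (x := v) (y := n))
      hDpos.le
    rw [dist_eq_norm] at h2
    have h3 : ‖n‖ ≤ ‖v - n‖ + ‖v‖ := by
      simpa using norm_sub_le (v - n) v
    have h4 := mul_le_mul_of_nonneg_left h3 hcσ
    linarith
  have hmain : ∀ n ∈ N, D * infDist x N - infDist w (relMul0 A) ≤
      2 * (‖c‖ * σ) * dist x n := by
    intro n hn
    obtain ⟨y, z, hy, hz, hyz⟩ := sub_mem_of_mem_relKer hw hn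
    change w = y - c • z at hyz
    have hinv : infDist x N ≤ infDist (x - n) N := by
      refine (le_infDist (relKer_nonempty _)).2 fun m hm => ?_
      have hmem : n + m ∈ N := ((subRel c A B).comap (LinearMap.inl ℂ X Y)).add_mem hn hm
      refine (infDist_le_dist_of_mem hmem).trans_eq ?_
      rw [dist_eq_norm, dist_eq_norm, sub_sub]
    have h1 := one_sub_mul_infDist_relMul0_le h0 hrb c hy hz
    rw [← hyz] at h1
    have h2 := mul_le_mul_of_nonneg_left (hlb _ _ hy) hcτ.le
    have h3 := hgap (x - n)
    have h4 : D + ‖c‖ * σ = (1 - ‖c‖ * τ) * γ := by rw [hD]; ring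
    rw [h4] at h3
    have h5 := mul_le_mul_of_nonneg_left hinv hDpos.le
    rw [dist_eq_norm]
    linarith
  have hinf : D * infDist x N - infDist w (relMul0 A) ≤ 2 * (‖c‖ * σ) * infDist x N := by
    refine le_of_forall_pos_le_add fun ε hε => ?_
    have hK : 0 < 2 * (‖c‖ * σ) + 1 := by linarith
    obtain ⟨n, hn, hlt⟩ := (infDist_lt_iff (relKer_nonempty _)).1
      (lt_add_of_pos_right (infDist x N) (div_pos hε hK))
    have h1 := mul_le_mul_of_nonneg_left hlt.le (by linarith : 0 ≤ 2 * (‖c‖ * σ))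
    have h2 : 2 * (‖c‖ * σ) * (ε / (2 * (‖c‖ * σ) + 1)) ≤ ε := by
      rw [mul_div_assoc', div_le_iff₀ hK]
      nlinarith
    have h3 := hmain n hn
    linarith
  rw [hD] at hinf
  linarith

theorem isClosed_relRan_subRel [CompleteSpace X] [CompleteSpace Y]
    (hA : IsClosed (A : Set (X × Y))) (hB : IsClosed (B : Set (X × Y)))
    (h0 : relMul0 B ⊆ relMul0 A) (hσ : 0 ≤ σ) (hτ : 0 ≤ τ)
    (hrb : ∀ x y, (x, y) ∈ A → ∀ z, (x, z) ∈ B →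
      infDist z (relMul0 B) ≤ σ * ‖x‖ + τ * infDist y (relMul0 A))
    {c : ℂ} (hcτ : ‖c‖ * τ < 1) {δ : ℝ} (hδ : 0 < δ)
    (hlb : ∀ x w, (x, w) ∈ subRel c A B →
      δ * infDist x (relKer (subRel c A B)) ≤ infDist w (relMul0 A)) :
    IsClosed (relRan (subRel c A B)) := by
  let G : Submodule ℂ (X × Y × Y) :=
    A.comap ((LinearMap.fst ℂ X (Y × Y)).prod (LinearMap.fst ℂ Y Y ∘ₗ LinearMap.snd ℂ X (Y × Y)))
    ⊓ B.comap
      ((LinearMap.fst ℂ X (Y × Y)).prod (LinearMap.snd ℂ Y Y ∘ₗ LinearMap.snd ℂ X (Y × Y)))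
  have hG : IsClosed (G : Set (X × Y × Y)) := by
    have h1 : Continuous fun p : X × Y × Y => (p.1, p.2.1) := by fun_prop
    have h2 : Continuous fun p : X × Y × Y => (p.1, p.2.2) := by fun_prop
    exact (hA.preimage h1).inter (hB.preimage h2)
  have : CompleteSpace G := hG.completeSpace_coe
  let F : G →L[ℂ] Y :=
    (ContinuousLinearMap.fst ℂ Y Y - c • ContinuousLinearMap.snd ℂ Y Y) ∘L
      ContinuousLinearMap.snd ℂ X (Y × Y) ∘L G.subtypeL
  let f : NormedAddGroupHom G Y :=
    F.toLinearMap.toAddMonoidHom.mkNormedAddGroupHom ‖F‖ F.le_opNorm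
  let K : AddSubgroup Y := ((subRel c A B).map (LinearMap.snd ℂ X Y)).toAddSubgroup
  have hK : (K : Set Y) = relRan (subRel c A B) := by
    ext w
    constructor
    · rintro ⟨⟨x, w'⟩, h, rfl⟩
      exact ⟨x, h⟩
    · rintro ⟨x, h⟩
      exact ⟨(x, w), h, rfl⟩
  have hpos : 0 < 1 - ‖c‖ * τ := by linarith
  set p := 2 / δ with hp
  set d := (1 + ‖c‖ * σ * p) / (1 - ‖c‖ * τ) with hd
  set e := σ * p + τ * d + 1 with he
  have hp0 : 0 < p := by positivity
  have hd0 : 0 < d := by positivity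
  have he0 : 0 < e := by positivity
  have hsurj : f.SurjectiveOnWith K (p + e + (1 + ‖c‖ * e)) := by
    intro w hw
    rcases eq_or_ne w 0 with rfl | hw0
    · exact ⟨0, by simp, by simp⟩
    have ht : 0 < ‖w‖ := norm_pos_iff.2 hw0
    obtain ⟨u, hu⟩ : w ∈ relRan (subRel c A B) := hK ▸ hw
    have hdist : infDist u (relKer (subRel c A B)) < p * ‖w‖ := by
      have h1 := (hlb u w hu).trans (infDist_relMul0_le_norm A w)
      rw [hp, div_mul_eq_mul_div, lt_div_iff₀' hδ]
      linarith
    obtain ⟨n, hn, hlt⟩ := exists_mem_relKer_norm_sub_lt hdist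
    obtain ⟨y, z, hy, hz, hyz⟩ := sub_mem_of_mem_relKer hu hn
    change w = y - c • z at hyz
    have hy_dist : infDist y (relMul0 A) ≤ d * ‖w‖ := by
      have h1 := one_sub_mul_infDist_relMul0_le h0 hrb c hy hz
      rw [← hyz] at h1
      have h2 := mul_le_mul_of_nonneg_left hlt.le (by positivity : 0 ≤ ‖c‖ * σ)
      have h3 := infDist_relMul0_le_norm A w
      rw [hd, div_mul_eq_mul_div, le_div_iff₀' hpos]
      dsimp only at h1
      linarith
    have hz_dist : infDist z (relMul0 B) < e * ‖w‖ := by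
      have h1 := hrb _ _ hy z hz
      have h2 := mul_le_mul_of_nonneg_left hlt.le hσ
      have h3 := mul_le_mul_of_nonneg_left hy_dist hτ
      rw [he]
      dsimp only at h1
      linarith
    obtain ⟨k, hk, hzk⟩ := exists_mem_relMul0_norm_sub_lt hz_dist
    have hck : c • k ∈ relMul0 A := (A.comap (LinearMap.inr ℂ X Y)).smul_mem c (h0 hk)
    have hw' : (y - c • k) - c • (z - k) = w := by rw [hyz, smul_sub]; abel
    have hyk : ‖y - c • k‖ ≤ (1 + ‖c‖ * e) * ‖w‖ := by
      have h1 : y - c • k = w + c • (z - k) := by rw [← hw']; abel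
      rw [h1]
      refine (norm_add_le _ _).trans ?_
      rw [norm_smul]
      have h2 := mul_le_mul_of_nonneg_left hzk.le (norm_nonneg c)
      linarith
    have hmem : (u - n, y - c • k, z - k) ∈ G :=
      ⟨sub_mem_of_mem_relMul0 hy hck, sub_mem_of_mem_relMul0 hz hk⟩
    refine ⟨⟨(u - n, y - c • k, z - k), hmem⟩, hw', ?_⟩
    have hpw : 0 ≤ p * ‖w‖ := by positivity
    have hew : 0 ≤ e * ‖w‖ := by positivity
    have hcw : 0 ≤ (1 + ‖c‖ * e) * ‖w‖ := by positivity
    change ‖(u - n, y - c • k, z - k)‖ ≤ _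
    refine norm_prod_le_iff.2 ⟨?_, norm_prod_le_iff.2 ⟨?_, ?_⟩⟩ <;> dsimp only <;> linarith
  rw [← hK, ← closure_subset_iff_isClosed]
  intro w hw
  obtain ⟨⟨⟨x, y, z⟩, hxy, hxz⟩, hg, -⟩ :=
    controlled_closure_of_complete (by positivity) one_pos hsurj w hw
  rw [hK]
  exact ⟨x, y, z, hxy, hxz, hg.symm⟩

end Normed

theorem stmt18 {X Y : Type*} [NormedAddCommGroup X] [NormedSpace ℂ X] [CompleteSpace X]
    [NormedAddCommGroup Y] [NormedSpace ℂ Y] [CompleteSpace Y]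
    (A B : Submodule ℂ (X × Y))
    (hA : IsClosed (A : Set (X × Y))) (hB : IsClosed (B : Set (X × Y)))
    (hRA : IsClosed (relRan A))
    (γ : ℝ) (hγ : 0 < γ)
    (hlb : ∀ x y, (x, y) ∈ A → γ * infDist x (relKer A) ≤ infDist y (closure (relMul0 A)))
    (hdom : relDom A ⊆ relDom B) (h0 : relMul0 B ⊆ relMul0 A)
    (σ τ : ℝ) (hσ : 0 ≤ σ) (hτ : 0 ≤ τ)
    (hrb : ∀ x y, (x, y) ∈ A → ∀ z, (x, z) ∈ B →
      infDist z (closure (relMul0 B)) ≤ σ * ‖x‖ + τ * infDist y (closure (relMul0 A)))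
    (hν : ∀ n : ℕ, relKer A ⊆ Mseq A B n) :
    ∀ lam : ℂ, ‖lam‖ * (3 * σ + τ * γ) < γ →
      IsClosed (relRan (subRel lam A B)) ∧
      ∀ x y, (x, y) ∈ subRel lam A B →
        (γ - ‖lam‖ * (3 * σ + τ * γ)) * infDist x (relKer (subRel lam A B)) ≤
          infDist y (closure (relMul0 (subRel lam A B))) := by
  simp only [infDist_closure] at hlb hrb ⊢
  intro lam hlam
  have hlσ : 0 ≤ ‖lam‖ * σ := by positivity
  have hc : ‖lam‖ * (σ + τ * γ) < γ := by linarith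
  have hlτ : ‖lam‖ * τ < 1 := by
    rw [← mul_lt_mul_iff_left₀ hγ]
    linarith
  have hbound := fun x w (hw : (x, w) ∈ subRel lam A B) =>
    lower_bound_subRel hA hB hγ hlb h0 hσ hτ hrb hν hc hw
  rw [relMul0_subRel h0]
  exact ⟨isClosed_relRan_subRel hA hB h0 hσ hτ hrb hlτ (sub_pos.2 hlam) hbound, hbound⟩
end

section
/- Let X and Y be complex Banach spaces. Let A be a closed linear relation from X to Y with closed range R(A), let γ > 0 be a lower bound for A, and let B be a closed linear relation from X to Y with D(A) ⊆ D(B), B(0) ⊆ A(0), which is relatively bounded with respect to A with constants σ, τ ≥ 0. Assume ν(A : B) = ∞, i.e. N(A) ⊆ M_n for every n ≥ 0. Then α(A − λB) and β(A − λB) are constant on the disk {λ ∈ ℂ : |λ|·(3σ + τγ) < γ}; in particular α(A − λB) = α(A) and β(A − λB) = β(A) for every such λ. -/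
open Metric Set

section Defs

variable {X Y : Type*} [AddCommGroup X] [Module ℂ X] [AddCommGroup Y] [Module ℂ Y]

/-- The null space `N(A)` of a linear relation, as a submodule of `X`. -/
def relKerS (A : Submodule ℂ (X × Y)) : Submodule ℂ X := A.comap (LinearMap.inl ℂ X Y)

/-- The range `R(A)` of a linear relation, as a submodule of `Y`. -/
def relRanS (A : Submodule ℂ (X × Y)) : Submodule ℂ Y := A.map (LinearMap.snd ℂ X Y)

end Defs

section HamelDimension

open Cardinal Filter Topology

/-- An infinite-dimensional normed space carries a triangular biorthogonal system of unit
vectors and functionals. -/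
theorem exists_triangular_dual_system {V : Type*} [NormedAddCommGroup V] [NormedSpace ℂ V]
    (hV : ℵ₀ ≤ Module.rank ℂ V) :
    ∃ (x : ℕ → V) (f : ℕ → V →L[ℂ] ℂ), (∀ n, ‖x n‖ = 1) ∧ (∀ n, f n (x n) = 1) ∧
      ∀ m n, m < n → f m (x n) = 0 := by
  obtain ⟨p, hp, hp'⟩ := exists_seq_of_forall_finset_exists
    (fun p : V × (V →L[ℂ] ℂ) => ‖p.1‖ = 1 ∧ p.2 p.1 = 1) (fun p q => p.2 q.1 = 0) (by
      intro s _
      let L : V →ₗ[ℂ] (s → ℂ) := LinearMap.pi fun p => (p.1.2 : V →ₗ[ℂ] ℂ)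
      have hL : ¬ Function.Injective L := by
        intro hinj
        have h1 := LinearMap.lift_rank_le_of_injective L hinj
        have h2 : Module.rank ℂ (s → ℂ) < ℵ₀ := Module.rank_lt_aleph0 ℂ _
        have h3 := (Cardinal.lift_le.2 hV).trans h1
        rw [Cardinal.lift_aleph0, Cardinal.aleph0_le_lift] at h3
        exact absurd h2 (not_lt.2 h3)
      have : ∃ v, L v = 0 ∧ v ≠ 0 := by
        by_contra! hcon
        exact hL ((injective_iff_map_eq_zero L).2 hcon)
      obtain ⟨v, hv, hv0⟩ := this
      have hn : ‖v‖ ≠ 0 := norm_ne_zero_iff.2 hv0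
      obtain ⟨g, _, hg⟩ := exists_dual_vector ℂ v hn
      refine ⟨(((‖v‖ : ℂ)⁻¹) • v, g), ⟨?_, ?_⟩, ?_⟩
      · simp [norm_smul, hn]
      · simp [hg, hn]
      · intro q hq
        have := congrFun hv ⟨q, hq⟩
        simp only [L, LinearMap.pi_apply, Pi.zero_apply] at this
        simp only [map_smul]
        erw [this]
        simp)
  exact ⟨fun n => (p n).1, fun n => (p n).2, fun n => (hp n).1, fun n => (hp n).2, hp'⟩

theorem continuum_le_rank_of_aleph0_le_rank {V : Type*} [NormedAddCommGroup V] [NormedSpace ℂ V]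
    [CompleteSpace V] (hV : ℵ₀ ≤ Module.rank ℂ V) : 𝔠 ≤ Module.rank ℂ V := by
  obtain ⟨x, f, hx, hf, hfx⟩ := exists_triangular_dual_system hV
  let v : Ioo (0 : ℝ) 1 → V := fun t => ∑' n, ((t : ℝ) : ℂ) ^ n • x n
  have hsum : ∀ t : Ioo (0 : ℝ) 1, Summable fun n => ((t : ℝ) : ℂ) ^ n • x n := by
    intro t
    refine Summable.of_norm ?_
    simpa [norm_smul, hx, abs_of_pos t.2.1] using
      summable_geometric_of_lt_one t.2.1.le t.2.2
  have hli : LinearIndependent ℂ v := by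
    rw [linearIndependent_iff']
    intro s c hc t ht
    have hS : HasSum (fun n => (∑ u ∈ s, c u * ((u : ℝ) : ℂ) ^ n) • x n) 0 := by
      rw [← hc]
      have := hasSum_sum (s := s) fun u _ => (hsum u).hasSum.const_smul (c u)
      simpa only [Finset.sum_smul, mul_smul] using this
    have ha : ∀ n, ∑ u ∈ s, c u * ((u : ℝ) : ℂ) ^ n = 0 := by
      intro n
      induction n using Nat.strong_induction_on with
      | _ n ih =>
        have h1 := (f n).hasSum hS
        have h2 := h1.unique (hasSum_single n ?_)
        · simpa [hf] using h2.symm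
        · intro m hm
          rcases lt_or_gt_of_ne hm with h | h
          · simp [ih m h]
          · simp [hfx n m h]
    have hpoly : ∀ p : Polynomial ℂ, ∑ u ∈ s, c u * p.eval ((u : ℝ) : ℂ) = 0 := by
      intro p
      simp_rw [Polynomial.eval_eq_sum_range, Finset.mul_sum]
      rw [Finset.sum_comm]
      refine Finset.sum_eq_zero fun k _ => ?_
      have : ∀ u : Ioo (0 : ℝ) 1, c u * (p.coeff k * ((u : ℝ) : ℂ) ^ k) =
          p.coeff k * (c u * ((u : ℝ) : ℂ) ^ k) := fun u => by ring
      simp_rw [this, ← Finset.mul_sum, ha, mul_zero]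
    have h3 := hpoly (∏ u ∈ s.erase t, (Polynomial.X - Polynomial.C ((u : ℝ) : ℂ)))
    rw [Finset.sum_eq_single t] at h3
    · refine (mul_eq_zero.1 h3).resolve_right ?_
      rw [Polynomial.eval_prod]
      refine Finset.prod_ne_zero_iff.2 ?_
      intro u hu
      have : (u : ℝ) ≠ t := fun h => (Finset.ne_of_mem_erase hu) (Subtype.ext h)
      simp only [Polynomial.eval_sub, Polynomial.eval_X, Polynomial.eval_C]
      exact sub_ne_zero.2 fun h => this (Complex.ofReal_injective h.symm)
    · intro u hu hut
      rw [Polynomial.eval_prod, Finset.prod_eq_zero (Finset.mem_erase.2 ⟨hut, hu⟩) (by simp),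
        mul_zero]
    · intro h; exact absurd ht h
  have := hli.cardinal_lift_le_rank
  rwa [Cardinal.mk_Ioo_real zero_lt_one, Cardinal.lift_continuum,
    Cardinal.continuum_le_lift] at this

theorem rank_eq_mk_of_aleph0_le_rank {V : Type*} [NormedAddCommGroup V] [NormedSpace ℂ V]
    [CompleteSpace V] (hV : ℵ₀ ≤ Module.rank ℂ V) : Module.rank ℂ V = #V := by
  have hc := continuum_le_rank_of_aleph0_le_rank hV
  let b := Module.Basis.ofVectorSpace ℂ V
  have hb := b.mk_eq_rank''
  have hne : Nonempty (Module.Basis.ofVectorSpaceIndex ℂ V) := by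
    rw [← Cardinal.mk_ne_zero_iff, hb]
    exact (aleph0_pos.trans_le hV).ne'
  have h1 := Cardinal.mk_congr b.repr.toEquiv
  rw [Cardinal.mk_finsupp_lift_of_infinite', hb, Cardinal.mk_complex, Cardinal.lift_continuum,
    Cardinal.lift_id', max_eq_left hc] at h1
  exact h1.symm

end HamelDimension

section CardinalComparison

open Cardinal Filter Topology

/-- A maximal `1/2`-separated subset of the closed unit ball is a `1/2`-net of it. -/
theorem exists_half_separated_net (V : Type*) [NormedAddCommGroup V] :
    ∃ D : Set V, (∀ d ∈ D, ‖d‖ ≤ 1) ∧ (∀ d ∈ D, ∀ e ∈ D, d ≠ e → 1 / 2 ≤ ‖d - e‖) ∧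
      ∀ v : V, ‖v‖ ≤ 1 → ∃ d ∈ D, ‖v - d‖ ≤ 1 / 2 := by
  obtain ⟨D, hD⟩ := zorn_subset
    {D : Set V | (∀ d ∈ D, ‖d‖ ≤ 1) ∧ ∀ d ∈ D, ∀ e ∈ D, d ≠ e → 1 / 2 ≤ ‖d - e‖} (by
      intro c hc hchain
      refine ⟨⋃₀ c, ⟨?_, ?_⟩, fun s hs => subset_sUnion_of_mem hs⟩
      · rintro d ⟨s, hs, hd⟩
        exact (hc hs).1 d hd
      · rintro d ⟨s, hs, hd⟩ e ⟨t, ht, he⟩ hde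
        rcases hchain.total hs ht with h | h
        · exact (hc ht).2 d (h hd) e he hde
        · exact (hc hs).2 d hd e (h he) hde)
  refine ⟨D, hD.prop.1, hD.prop.2, fun v hv => ?_⟩
  by_contra! hcon
  have hins : insert v D ∈
      {D : Set V | (∀ d ∈ D, ‖d‖ ≤ 1) ∧ ∀ d ∈ D, ∀ e ∈ D, d ≠ e → 1 / 2 ≤ ‖d - e‖} := by
    refine ⟨?_, ?_⟩
    · rintro d (rfl | hd)
      exacts [hv, hD.prop.1 d hd]
    · rintro d (rfl | hd) e (rfl | he) hde
      · exact absurd rfl hde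
      · exact (hcon e he).le
      · rw [norm_sub_rev]; exact (hcon d hd).le
      · exact hD.prop.2 d hd e he hde
  have hvD : v ∈ D := hD.le_of_ge hins (subset_insert v D) (mem_insert v D)
  have := hcon v hvD
  norm_num at this

/-- If a map from the unit ball of `V` to a Banach space `W` is bounded and keeps `1/2`-separated
points uniformly separated, then `V` has at most as many points as `W`. -/
theorem mk_le_of_separating_map.{u} {V W : Type u} [NormedAddCommGroup V] [NormedSpace ℂ V]
    [NormedAddCommGroup W] [NormedSpace ℂ W] [CompleteSpace W] (f : V → W) (C η : ℝ) (hη : 0 < η)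
    (hC : ∀ v, ‖v‖ ≤ 1 → ‖f v‖ ≤ C)
    (hsep : ∀ v w, ‖v‖ ≤ 1 → ‖w‖ ≤ 1 → 1 / 2 ≤ ‖v - w‖ → η ≤ ‖f v - f w‖) :
    #V ≤ #W := by
  obtain ⟨D, hD1, hDsep, hDnet⟩ := exists_half_separated_net V
  have hC0 : 0 ≤ C := (norm_nonneg _).trans (hC 0 (by simp))
  -- binary digits of points of the ball
  choose! d hdD hd using hDnet
  let φ : V → V := fun v => (2 : ℂ) • (v - d v)
  have hφ : ∀ v, ‖v‖ ≤ 1 → ‖φ v‖ ≤ 1 := fun v hv => by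
    have := hd v hv
    simp only [φ, norm_smul, Complex.norm_ofNat]
    linarith
  have hφn : ∀ n v, ‖v‖ ≤ 1 → ‖φ^[n] v‖ ≤ 1 := by
    intro n
    induction n with
    | zero => intro v hv; simpa using hv
    | succ n ih => intro v hv; rw [Function.iterate_succ_apply]; exact ih _ (hφ v hv)
  let dig : closedBall (0 : V) 1 → ℕ → D := fun v n =>
    ⟨d (φ^[n] v), hdD _ (hφn n _ (mem_closedBall_zero_iff.1 v.2))⟩
  have hdig : Function.Injective dig := by
    intro v w hvw
    have key : ∀ n, φ^[n] (v : V) - φ^[n] (w : V) = (2 : ℂ) ^ n • ((v : V) - w) := by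
      intro n
      induction n with
      | zero => simp
      | succ n ih =>
        have h := congrArg Subtype.val (congrFun hvw n)
        simp only [dig] at h
        rw [Function.iterate_succ_apply', Function.iterate_succ_apply']
        simp only [φ] at h ih ⊢
        rw [← smul_sub, h, sub_sub_sub_cancel_right, ih, smul_smul, pow_succ']
    have hv : ‖(v : V)‖ ≤ 1 := mem_closedBall_zero_iff.1 v.2
    have hw : ‖(w : V)‖ ≤ 1 := mem_closedBall_zero_iff.1 w.2
    have hb : ∀ n : ℕ, (2 : ℝ) ^ n * ‖(v : V) - w‖ ≤ 2 := by
      intro n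
      have := norm_sub_le (φ^[n] (v : V)) (φ^[n] (w : V))
      rw [key, norm_smul, norm_pow, Complex.norm_ofNat] at this
      linarith [hφn n _ hv, hφn n _ hw]
    by_contra hne
    have hpos : 0 < ‖(v : V) - w‖ := norm_pos_iff.2 (sub_ne_zero.2 fun h => hne (Subtype.ext h))
    obtain ⟨n, hn⟩ := pow_unbounded_of_one_lt (2 / ‖(v : V) - w‖) (one_lt_two (α := ℝ))
    rw [div_lt_iff₀ hpos] at hn
    exact absurd (hb n) (not_le.2 hn)
  -- encoding of digit sequences in `W`
  obtain ⟨δ, hδ0, hδ1, hδη⟩ : ∃ δ : ℝ, 0 < δ ∧ δ ≤ 1 / 2 ∧ δ * (4 * C) < η := by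
    refine ⟨min (1 / 2) (η / (4 * C + 1)), by positivity, min_le_left _ _, ?_⟩
    calc min (1 / 2) (η / (4 * C + 1)) * (4 * C) ≤ η / (4 * C + 1) * (4 * C) := by
          gcongr; exact min_le_right _ _
      _ < η := by
          rw [div_mul_eq_mul_div, div_lt_iff₀ (by positivity)]; nlinarith
  have hfD : ∀ e : D, ‖f e‖ ≤ C := fun e => hC _ (hD1 _ e.2)
  have hbd : ∀ (a : ℕ → D) (n : ℕ), ‖(δ : ℂ) ^ n • f (a n)‖ ≤ C * (1 / 2) ^ n := by
    intro a n
    rw [norm_smul, norm_pow, Complex.norm_real, Real.norm_of_nonneg hδ0.le, mul_comm]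
    gcongr
    exact hfD _
  have hgeo : HasSum (fun n : ℕ => C * (1 / 2 : ℝ) ^ n) (C * 2) := hasSum_geometric_two.mul_left C
  have hsum : ∀ a : ℕ → D, Summable fun n => (δ : ℂ) ^ n • f (a n) := fun a =>
    Summable.of_norm_bounded hgeo.summable (hbd a)
  let G : (ℕ → D) → W := fun a => ∑' n, (δ : ℂ) ^ n • f (a n)
  have hG : ∀ a, ‖G a‖ ≤ C * 2 := fun a => tsum_of_norm_bounded hgeo (hbd a)
  have hGs : ∀ a, G a = f (a 0) + (δ : ℂ) • G (fun n => a (n + 1)) := by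
    intro a
    simp only [G]
    rw [(hsum a).tsum_eq_zero_add, ← (hsum fun n => a (n + 1)).tsum_const_smul]
    simp [smul_smul, pow_succ']
  have hG0 : ∀ a b, G a = G b →
      a 0 = b 0 ∧ G (fun n => a (n + 1)) = G (fun n => b (n + 1)) := by
    intro a b hab
    have h1 : f (a 0) - f (b 0) =
        (δ : ℂ) • (G (fun n => b (n + 1)) - G (fun n => a (n + 1))) := by
      rw [hGs a, hGs b] at hab
      rw [smul_sub, sub_eq_sub_iff_add_eq_add, hab, add_comm]
    have h0 : a 0 = b 0 := by
      by_contra hne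
      have h2 := hsep _ _ (hD1 _ (a 0).2) (hD1 _ (b 0).2)
        (hDsep _ (a 0).2 _ (b 0).2 fun h => hne (Subtype.ext h))
      rw [h1, norm_smul, Complex.norm_real, Real.norm_of_nonneg hδ0.le] at h2
      have h3 := norm_sub_le (G (fun n => b (n + 1))) (G (fun n => a (n + 1)))
      have h4 := hG (fun n => a (n + 1))
      have h5 := hG (fun n => b (n + 1))
      have : δ * ‖G (fun n => b (n + 1)) - G (fun n => a (n + 1))‖ ≤ δ * (4 * C) := by
        gcongr; linarith
      linarith
    refine ⟨h0, ?_⟩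
    rw [h0, sub_self, eq_comm, smul_eq_zero] at h1
    rcases h1 with h1 | h1
    · exact absurd (Complex.ofReal_eq_zero.1 h1) hδ0.ne'
    · exact (sub_eq_zero.1 h1).symm
  have hGinj : Function.Injective G := by
    intro a b hab
    have : ∀ n, ∀ a b : ℕ → D, G a = G b → a n = b n := by
      intro n
      induction n with
      | zero => exact fun a b h => (hG0 a b h).1
      | succ n ih => exact fun a b h => ih _ _ (hG0 a b h).2
    exact funext fun n => this n a b hab
  have hball : #(closedBall (0 : V) 1) = #V :=
    cardinal_eq_of_mem_nhds_zero ℂ (closedBall_mem_nhds _ one_pos)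
  rw [← hball]
  exact Cardinal.mk_le_of_injective (hGinj.comp hdig)

end CardinalComparison

section Perturbation

open Filter Topology

variable {E F : Type*} [NormedAddCommGroup E] [NormedSpace ℂ E]
  [NormedAddCommGroup F] [NormedSpace ℂ F]

/-- Approximate solvability with a contraction factor gives exact solvability. -/
theorem exists_preimage_of_approx [CompleteSpace E] (Q : E →L[ℂ] F) {C q : ℝ} (hC : 0 ≤ C)
    (hq : 0 ≤ q) (hq1 : q < 1) (h : ∀ y, ∃ x, ‖x‖ ≤ C * ‖y‖ ∧ ‖y - Q x‖ ≤ q * ‖y‖) (y : F) :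
    ∃ x, Q x = y ∧ ‖x‖ ≤ C / (1 - q) * ‖y‖ := by
  choose g hg hgQ using h
  let r : ℕ → F := fun n => (fun w => w - Q (g w))^[n] y
  have hrs : ∀ n, r (n + 1) = r n - Q (g (r n)) := fun n =>
    Function.iterate_succ_apply' (fun w => w - Q (g w)) n y
  have hr : ∀ n, ‖r n‖ ≤ q ^ n * ‖y‖ := by
    intro n
    induction n with
    | zero => simp [r]
    | succ n ih =>
      rw [hrs, pow_succ', mul_assoc]
      exact (hgQ _).trans (by gcongr)
  have hgr : ∀ n, ‖g (r n)‖ ≤ C * ‖y‖ * q ^ n := fun n =>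
    (hg _).trans (by rw [mul_assoc, mul_comm ‖y‖]; gcongr; exact hr n)
  have hgeo : HasSum (fun n : ℕ => C * ‖y‖ * q ^ n) (C * ‖y‖ * (1 - q)⁻¹) :=
    (hasSum_geometric_of_lt_one hq hq1).mul_left _
  have hs : Summable fun n => g (r n) := Summable.of_norm_bounded hgeo.summable hgr
  refine ⟨∑' n, g (r n), ?_, ?_⟩
  · have h1 := (Q.hasSum hs.hasSum).tendsto_sum_nat
    have h2 : ∀ n, ∑ i ∈ Finset.range n, Q (g (r i)) = y - r n := by
      intro n
      induction n with
      | zero => simp [r]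
      | succ n ih => rw [Finset.sum_range_succ, ih, hrs]; abel
    simp_rw [h2] at h1
    have h3 : Tendsto r atTop (𝓝 0) := by
      refine squeeze_zero_norm hr ?_
      simpa using (tendsto_pow_atTop_nhds_zero_of_lt_one hq hq1).mul_const ‖y‖
    exact tendsto_nhds_unique h1 (by simpa using h3.const_sub y)
  · refine (tsum_of_norm_bounded hgeo hgr).trans_eq ?_
    rw [div_eq_mul_inv]; ring

/-- `Q` is surjective with preimages controlled by the constant `C`. -/
def SurjectiveWith (Q : E →L[ℂ] F) (C : ℝ) : Prop := ∀ y, ∃ x, Q x = y ∧ ‖x‖ ≤ C * ‖y‖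

/-- `Q` is bounded below with constant `C`. -/
def BoundedBelowWith (Q : E →L[ℂ] F) (C : ℝ) : Prop := ∀ x, ‖x‖ ≤ C * ‖Q x‖

theorem eventually_norm_sub_mul_le (P : E →L[ℂ] F) (C : ℝ) {ε : ℝ} (hε : 0 < ε) :
    ∀ᶠ Q in 𝓝 P, ‖Q - P‖ * C ≤ ε := by
  have : Tendsto (fun Q : E →L[ℂ] F => ‖Q - P‖ * C) (𝓝 P) (𝓝 (‖P - P‖ * C)) :=
    (Continuous.tendsto (by fun_prop) P)
  rw [sub_self, norm_zero, zero_mul] at this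
  exact (this.eventually (gt_mem_nhds hε)).mono fun _ h => h.le

theorem SurjectiveWith.perturb [CompleteSpace E] {P Q : E →L[ℂ] F} {C : ℝ} (hC : 0 ≤ C)
    (hP : SurjectiveWith P C) (hQ : ‖Q - P‖ * C ≤ 1 / 2) : SurjectiveWith Q (2 * C) := by
  intro y
  have := exists_preimage_of_approx Q hC (q := 1 / 2) (by norm_num) (by norm_num) (fun y => by
    obtain ⟨x, hx, hxy⟩ := hP y
    refine ⟨x, hxy, ?_⟩
    calc ‖y - Q x‖ = ‖(Q - P) x‖ := by
          rw [sub_apply, hx, norm_sub_rev]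
      _ ≤ ‖Q - P‖ * (C * ‖y‖) := ((Q - P).le_opNorm x).trans (by gcongr)
      _ ≤ 1 / 2 * ‖y‖ := by rw [← mul_assoc]; gcongr) y
  obtain ⟨x, hx, hxy⟩ := this
  refine ⟨x, hx, hxy.trans_eq ?_⟩
  ring

theorem BoundedBelowWith.perturb {P Q : E →L[ℂ] F} {C : ℝ} (hC : 0 ≤ C)
    (hP : BoundedBelowWith P C) (hQ : ‖Q - P‖ * C ≤ 1 / 2) : BoundedBelowWith Q (2 * C) := by
  intro x
  have h1 : ‖P x‖ ≤ ‖Q x‖ + ‖Q - P‖ * ‖x‖ := by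
    have h := (Q - P).le_opNorm x
    have h2 : P x = Q x - (Q - P) x := by simp
    rw [h2]
    exact (norm_sub_le _ _).trans (by gcongr)
  have h2 : ‖x‖ ≤ C * ‖Q x‖ + 1 / 2 * ‖x‖ := by
    calc ‖x‖ ≤ C * ‖P x‖ := hP x
      _ ≤ C * (‖Q x‖ + ‖Q - P‖ * ‖x‖) := by gcongr
      _ = C * ‖Q x‖ + ‖Q - P‖ * C * ‖x‖ := by ring
      _ ≤ _ := by gcongr
  linarith

theorem BoundedBelowWith.injective {P : E →L[ℂ] F} {C : ℝ} (hP : BoundedBelowWith P C) :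
    Function.Injective P := by
  rw [injective_iff_map_eq_zero]
  intro x hx
  have := hP x
  rw [hx, norm_zero, mul_zero] at this
  exact norm_le_zero_iff.1 this

theorem BoundedBelowWith.isClosed_range [CompleteSpace E] {P : E →L[ℂ] F} {C : ℝ}
    (hC : 0 ≤ C) (hP : BoundedBelowWith P C) : IsClosed (P.range : Set F) := by
  have : AntilipschitzWith ⟨C, hC⟩ P := P.antilipschitz_of_bound hP
  exact this.isClosed_range P.uniformContinuous

theorem exists_surjectiveWith [CompleteSpace E] [CompleteSpace F] {P : E →L[ℂ] F}
    (hP : Function.Surjective P) : ∃ C, 0 ≤ C ∧ SurjectiveWith P C := by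
  obtain ⟨C, hC, h⟩ := P.exists_preimage_norm_le hP
  exact ⟨C, hC.le, h⟩

theorem eventually_surjective [CompleteSpace E] [CompleteSpace F] {P : E →L[ℂ] F}
    (hP : Function.Surjective P) : ∀ᶠ Q : E →L[ℂ] F in 𝓝 P, Function.Surjective Q := by
  obtain ⟨C, hC, h⟩ := exists_surjectiveWith hP
  filter_upwards [eventually_norm_sub_mul_le P C one_half_pos] with Q hQ y
  obtain ⟨x, hx, -⟩ := h.perturb hC hQ y
  exact ⟨x, hx⟩

theorem BoundedBelowWith.eventually_injective {P : E →L[ℂ] F} {C : ℝ} (hC : 0 ≤ C)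
    (hP : BoundedBelowWith P C) : ∀ᶠ Q : E →L[ℂ] F in 𝓝 P, Function.Injective Q := by
  filter_upwards [eventually_norm_sub_mul_le P C one_half_pos] with Q hQ
  exact (hP.perturb hC hQ).injective

theorem exists_submodule_finrank_eq {V : Type*} [AddCommGroup V] [Module ℂ V] {n : ℕ}
    (h : (n : Cardinal) ≤ Module.rank ℂ V) :
    ∃ K : Submodule ℂ V, FiniteDimensional ℂ K ∧ Module.rank ℂ K = n := by
  obtain ⟨v, hv⟩ := Module.le_rank_iff.1 h
  have : FiniteDimensional ℂ (Submodule.span ℂ (range v)) :=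
    FiniteDimensional.span_of_finite ℂ (finite_range v)
  refine ⟨Submodule.span ℂ (range v), this, ?_⟩
  rw [← Module.finrank_eq_rank, finrank_span_eq_card hv, Fintype.card_fin]

theorem tendsto_prod {K : Type*} [NormedAddCommGroup K] [NormedSpace ℂ K] (P : E →L[ℂ] F)
    (π : E →L[ℂ] K) : Tendsto (fun Q : E →L[ℂ] F => Q.prod π) (𝓝 P) (𝓝 (P.prod π)) := by
  have h : ∀ Q : E →L[ℂ] F, Q.prod π =
      (ContinuousLinearMap.inl ℂ F K).comp Q + (ContinuousLinearMap.inr ℂ F K).comp π := by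
    intro Q; ext x <;> simp
  simp_rw [h]
  exact Continuous.tendsto (by fun_prop) P

theorem prod_surjective_of_le_ker {P : E →L[ℂ] F} (hP : Function.Surjective P)
    {K : Submodule ℂ E} (hK : K ≤ P.ker) {π : E →L[ℂ] K} (hπ : ∀ x : K, π x = x) :
    Function.Surjective (P.prod π) := by
  rintro ⟨w, k⟩
  obtain ⟨m, hm⟩ := hP w
  refine ⟨m + (k - π m : K), ?_⟩
  have h1 : P ((k - π m : K) : E) = 0 := hK (k - π m).2
  simp [ContinuousLinearMap.prod_apply, hπ, hm, -AddSubgroupClass.coe_sub, h1]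

section Kernel

variable [CompleteSpace E] [CompleteSpace F]

theorem eventually_le_rank_ker {P : E →L[ℂ] F} (hP : Function.Surjective P) {n : ℕ}
    (hn : (n : Cardinal) ≤ Module.rank ℂ P.ker) :
    ∀ᶠ Q : E →L[ℂ] F in 𝓝 P, (n : Cardinal) ≤ Module.rank ℂ Q.ker := by
  obtain ⟨K', _, hKn⟩ := exists_submodule_finrank_eq hn
  let K : Submodule ℂ E := K'.map P.ker.subtype
  have hK : K ≤ P.ker := Submodule.map_subtype_le _ _
  have hKr : Module.rank ℂ K = n :=
    (Submodule.equivSubtypeMap P.ker K').symm.rank_eq.trans hKn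
  obtain ⟨π, hπ⟩ := Submodule.ClosedComplemented.of_finiteDimensional K
  have hs := prod_surjective_of_le_ker hP hK hπ
  filter_upwards [(tendsto_prod P π).eventually (eventually_surjective hs)] with Q hQ
  rw [← hKr]
  refine LinearMap.rank_le_of_surjective ((π : E →ₗ[ℂ] K).comp Q.ker.subtype) fun k => ?_
  obtain ⟨x, hx⟩ := hQ (0, k)
  simp only [ContinuousLinearMap.prod_apply, Prod.mk.injEq] at hx
  exact ⟨⟨x, hx.1⟩, hx.2⟩

theorem eventually_rank_ker_le {P : E →L[ℂ] F} (hP : Function.Surjective P) {n : ℕ}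
    (hn : Module.rank ℂ P.ker ≤ n) :
    ∀ᶠ Q : E →L[ℂ] F in 𝓝 P, Module.rank ℂ Q.ker ≤ n := by
  have : FiniteDimensional ℂ P.ker :=
    Module.rank_lt_aleph0_iff.1 (hn.trans_lt (Cardinal.natCast_lt_aleph0))
  obtain ⟨π, hπ⟩ := Submodule.ClosedComplemented.of_finiteDimensional P.ker
  have hs := prod_surjective_of_le_ker hP le_rfl hπ
  have hi : Function.Injective (P.prod π) := by
    rw [injective_iff_map_eq_zero]
    intro x hx
    simp only [ContinuousLinearMap.prod_apply, Prod.mk_eq_zero] at hx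
    have h := (hπ ⟨x, hx.1⟩).symm.trans hx.2
    exact congrArg Subtype.val h
  let e := ContinuousLinearEquiv.ofBijective (P.prod π) (LinearMap.ker_eq_bot.2 hi)
    (LinearMap.range_eq_top.2 hs)
  have hb : BoundedBelowWith (P.prod π) ‖(e.symm : F × P.ker →L[ℂ] E)‖ := fun x => by
    have h := (e.symm : F × P.ker →L[ℂ] E).le_opNorm (e x)
    rwa [ContinuousLinearEquiv.coe_coe, e.symm_apply_apply] at h
  filter_upwards [(tendsto_prod P π).eventually
    (hb.eventually_injective (norm_nonneg _))] with Q hQ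
  refine le_trans ?_ hn
  refine LinearMap.rank_le_of_injective ((π : E →ₗ[ℂ] P.ker).comp Q.ker.subtype) ?_
  rw [injective_iff_map_eq_zero]
  intro x hx
  have hx' : π x = 0 := hx
  have h0 : Q x = 0 := x.2
  refine Subtype.ext (hQ ?_)
  simp [hx', h0]

end Kernel

section Cokernel

theorem tendsto_coprod {K : Type*} [NormedAddCommGroup K] [NormedSpace ℂ K] (P : E →L[ℂ] F)
    (s : K →L[ℂ] F) : Tendsto (fun Q : E →L[ℂ] F => Q.coprod s) (𝓝 P) (𝓝 (P.coprod s)) := by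
  have h : ∀ Q : E →L[ℂ] F, Q.coprod s =
      Q.comp (ContinuousLinearMap.fst ℂ E K) + s.comp (ContinuousLinearMap.snd ℂ E K) := by
    intro Q; ext x <;> simp
  simp_rw [h]
  exact Continuous.tendsto (by fun_prop) P

/-- A finite-dimensional subspace of the cokernel lifts continuously. -/
theorem exists_section_of_finiteDimensional {P : E →L[ℂ] F} [IsClosed (P.range : Set F)]
    (K : Submodule ℂ (F ⧸ P.range)) [FiniteDimensional ℂ K] :
    ∃ s : K →L[ℂ] F, ∀ k, P.range.mkQ (s k) = k := by
  obtain ⟨t, ht⟩ := P.range.mkQ.exists_rightInverse_of_surjective P.range.range_mkQ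
  refine ⟨(t.comp K.subtype).toContinuousLinearMap, fun k => ?_⟩
  exact LinearMap.congr_fun ht (k : F ⧸ P.range)

variable [CompleteSpace E]

theorem eventually_le_rank_coker {P : E →L[ℂ] F} {C : ℝ} (hC : 0 ≤ C) (hP : BoundedBelowWith P C)
    {n : ℕ} (hn : (n : Cardinal) ≤ Module.rank ℂ (F ⧸ P.range)) :
    ∀ᶠ Q : E →L[ℂ] F in 𝓝 P, (n : Cardinal) ≤ Module.rank ℂ (F ⧸ Q.range) := by
  have := hP.isClosed_range hC
  obtain ⟨K, _, hKn⟩ := exists_submodule_finrank_eq hn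
  obtain ⟨s, hs⟩ := exists_section_of_finiteDimensional K
  have hb : BoundedBelowWith (P.coprod s) (1 + C * (1 + ‖s‖)) := by
    rintro ⟨u, k⟩
    set w := P.coprod s (u, k) with hw
    have hw' : w = P u + s k := by simp [hw]
    have hk : ‖k‖ ≤ ‖w‖ := by
      have h1 : P.range.mkQ w = (k : F ⧸ P.range) := by
        rw [hw', map_add, hs]
        have : P.range.mkQ (P u) = 0 :=
          (Submodule.Quotient.mk_eq_zero _).2 ⟨u, rfl⟩
        rw [this, zero_add]
      calc ‖k‖ = ‖P.range.mkQ w‖ := by rw [h1]; rfl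
        _ ≤ ‖w‖ := Submodule.Quotient.norm_mk_le _ _
    have hu : ‖u‖ ≤ C * (1 + ‖s‖) * ‖w‖ := by
      have h2 : P u = w - s k := by rw [hw', add_sub_cancel_right]
      calc ‖u‖ ≤ C * ‖P u‖ := hP u
        _ ≤ C * (‖w‖ + ‖s‖ * ‖w‖) := by
          rw [h2]
          gcongr
          exact (norm_sub_le _ _).trans (by gcongr; exact (s.le_opNorm k).trans (by gcongr))
        _ = _ := by ring
    have hpos : 0 ≤ C * (1 + ‖s‖) * ‖w‖ := by positivity
    rw [Prod.norm_mk, add_mul, one_mul]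
    exact max_le (by linarith [norm_nonneg w]) (by linarith)
  filter_upwards [(tendsto_coprod P s).eventually
    (hb.eventually_injective (by positivity))] with Q hQ
  rw [← hKn]
  refine LinearMap.rank_le_of_injective (Q.range.mkQ.comp (s : K →ₗ[ℂ] F)) ?_
  rw [injective_iff_map_eq_zero]
  intro k hk
  obtain ⟨u, hu⟩ := (Submodule.Quotient.mk_eq_zero _).1 hk
  have hu' : Q u = s k := hu
  have h0 : ((-u, k) : E × K) = 0 := by
    refine hQ ?_
    simp [hu']
  exact (Prod.mk_eq_zero.1 h0).2

theorem eventually_rank_coker_le [CompleteSpace F] {P : E →L[ℂ] F} {C : ℝ} (hC : 0 ≤ C)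
    (hP : BoundedBelowWith P C) {n : ℕ} (hn : Module.rank ℂ (F ⧸ P.range) ≤ n) :
    ∀ᶠ Q : E →L[ℂ] F in 𝓝 P, Module.rank ℂ (F ⧸ Q.range) ≤ n := by
  have := hP.isClosed_range hC
  have : FiniteDimensional ℂ (F ⧸ P.range) :=
    Module.rank_lt_aleph0_iff.1 (hn.trans_lt (Cardinal.natCast_lt_aleph0))
  obtain ⟨s, hs⟩ := exists_section_of_finiteDimensional (⊤ : Submodule ℂ (F ⧸ P.range))
  have : CompleteSpace (⊤ : Submodule ℂ (F ⧸ P.range)) := FiniteDimensional.complete ℂ _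
  have hsurj : Function.Surjective (P.coprod s) := by
    intro w
    have h := hs ⟨P.range.mkQ w, trivial⟩
    obtain ⟨u, hu⟩ := (Submodule.Quotient.eq P.range).1 h.symm
    refine ⟨(u, ⟨P.range.mkQ w, trivial⟩), ?_⟩
    have hu' : P u = w - s ⟨P.range.mkQ w, trivial⟩ := hu
    rw [ContinuousLinearMap.coprod_apply, hu', sub_add_cancel]
  filter_upwards [(tendsto_coprod P s).eventually (eventually_surjective hsurj)] with Q hQ
  refine le_trans ?_ (rank_top ℂ (F ⧸ P.range) ▸ hn)
  refine LinearMap.rank_le_of_surjective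
    (Q.range.mkQ.comp (s : (⊤ : Submodule ℂ (F ⧸ P.range)) →ₗ[ℂ] F)) fun y => ?_
  obtain ⟨w, rfl⟩ := Q.range.mkQ_surjective y
  obtain ⟨⟨u, k⟩, h⟩ := hQ w
  refine ⟨k, (Submodule.Quotient.eq _).2 ⟨-u, ?_⟩⟩
  rw [← h]
  simp

end Cokernel

section CardinalOfKernel

open Cardinal

theorem mk_ker_le_mk_ker [CompleteSpace E] {P Q : E →L[ℂ] F} {C : ℝ} (hQ : SurjectiveWith Q C)
    (hPQ : ‖P - Q‖ * C ≤ 1 / 8) (hC : 0 ≤ C) : #P.ker ≤ #Q.ker := by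
  choose g hg hgn using hQ
  have hmem : ∀ v : P.ker, (v : E) - g (Q v) ∈ Q.ker := fun v => by
    simp [LinearMap.mem_ker, hg]
  have hsmall : ∀ v : P.ker, ‖v‖ ≤ 1 → ‖g (Q v)‖ ≤ 1 / 8 := by
    intro v hv
    have h0 : P v = 0 := v.2
    have h1 : ‖Q v‖ ≤ ‖P - Q‖ := by
      have h := (P - Q).le_of_opNorm_le le_rfl (v : E)
      rw [sub_apply, h0, zero_sub, norm_neg] at h
      exact h.trans (mul_le_of_le_one_right (norm_nonneg _) hv)
    calc ‖g (Q v)‖ ≤ C * ‖Q v‖ := hgn _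
      _ ≤ C * ‖P - Q‖ := by gcongr
      _ ≤ 1 / 8 := by rwa [mul_comm]
  have : CompleteSpace Q.ker := Q.isClosed_ker.completeSpace_coe
  refine mk_le_of_separating_map (fun v : P.ker => (⟨v - g (Q v), hmem v⟩ : Q.ker)) 2 (1 / 4)
    (by norm_num) (fun v hv => ?_) fun v w hv hw hvw => ?_
  · have h := norm_sub_le (v : E) (g (Q v))
    have h2 := hsmall v hv
    have h3 : ‖(v : E)‖ ≤ 1 := hv
    change ‖(v : E) - g (Q v)‖ ≤ 2
    linarith
  · change 1 / 4 ≤ ‖((v : E) - g (Q v)) - ((w : E) - g (Q w))‖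
    have h1 : (v : E) - w =
        (((v : E) - g (Q v)) - ((w : E) - g (Q w))) + (g (Q v) - g (Q w)) := by abel
    have h2 : 1 / 2 ≤ ‖(v : E) - w‖ := hvw
    rw [h1] at h2
    have h3 := norm_add_le (((v : E) - g (Q v)) - ((w : E) - g (Q w))) (g (Q v) - g (Q w))
    have h4 := norm_sub_le (g (Q v)) (g (Q w))
    linarith [hsmall v hv, hsmall w hw]

theorem eventually_mk_ker_eq [CompleteSpace E] {P : E →L[ℂ] F} {C : ℝ} (hC : 0 ≤ C)
    (hP : SurjectiveWith P C) : ∀ᶠ Q : E →L[ℂ] F in 𝓝 P, #Q.ker = #P.ker := by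
  filter_upwards [eventually_norm_sub_mul_le P C (ε := 1 / 16) (by norm_num)] with Q hQ
  refine le_antisymm (mk_ker_le_mk_ker hP (by linarith) hC)
    (mk_ker_le_mk_ker (hP.perturb hC (hQ.trans (by norm_num))) ?_ (by linarith))
  rw [norm_sub_rev]
  linarith

theorem mk_coker_le_mk_coker [CompleteSpace F] {P Q : E →L[ℂ] F} {C : ℝ}
    (hPc : IsClosed (P.range : Set F)) (hQc : IsClosed (Q.range : Set F))
    (hQ : BoundedBelowWith Q C) (hPQ : ‖P - Q‖ * C ≤ 1 / 32) :
    #(F ⧸ P.range) ≤ #(F ⧸ Q.range) := by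
  have hrep : ∀ x : F ⧸ P.range, ∃ y, P.range.mkQ y = x ∧ ‖y‖ < ‖x‖ + 1 := fun x =>
    Submodule.Quotient.norm_mk_lt x one_pos
  choose r hr hrn using hrep
  refine mk_le_of_separating_map (fun x => Q.range.mkQ (r x)) 2 (1 / 4) (by norm_num)
    (fun v hv => ?_) fun v w hv hw hvw => ?_
  · exact (Submodule.Quotient.norm_mk_le _ _).trans (by linarith [hrn v])
  · by_contra! hlt
    rw [← map_sub] at hlt
    obtain ⟨z, hz, hzn⟩ := (QuotientAddGroup.norm_lt_iff (S := Q.range.toAddSubgroup)).1 hlt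
    obtain ⟨u, hu⟩ := (Submodule.Quotient.eq Q.range).1 hz.symm
    have hu' : Q u = r v - r w - z := hu
    have h1 : ‖Q u‖ ≤ 17 / 4 := by
      rw [hu']
      have := norm_sub_le (r v - r w) z
      have := norm_sub_le (r v) (r w)
      linarith [hrn v, hrn w]
    have h2 : ‖(P - Q) u‖ ≤ 1 / 7 := by
      calc ‖(P - Q) u‖ ≤ ‖P - Q‖ * (C * ‖Q u‖) :=
            ((P - Q).le_opNorm u).trans (by gcongr; exact hQ u)
        _ = ‖P - Q‖ * C * ‖Q u‖ := by ring
        _ ≤ 1 / 32 * (17 / 4) := by gcongr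
        _ ≤ 1 / 7 := by norm_num
    have h3 : v - w = P.range.mkQ (z - (P - Q) u) := by
      rw [← hr v, ← hr w, ← map_sub]
      refine (Submodule.Quotient.eq _).2 ⟨u, ?_⟩
      change P u = _
      rw [sub_apply, hu']
      abel
    have h4 : ‖v - w‖ ≤ ‖z - (P - Q) u‖ := by
      rw [h3]; exact Submodule.Quotient.norm_mk_le _ _
    have h5 := norm_sub_le z ((P - Q) u)
    linarith

theorem eventually_mk_coker_eq [CompleteSpace E] [CompleteSpace F] {P : E →L[ℂ] F} {C : ℝ}
    (hC : 0 ≤ C) (hP : BoundedBelowWith P C) :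
    ∀ᶠ Q : E →L[ℂ] F in 𝓝 P, #(F ⧸ Q.range) = #(F ⧸ P.range) := by
  filter_upwards [eventually_norm_sub_mul_le P C (ε := 1 / 64) (by norm_num)] with Q hQ
  have hQb := hP.perturb hC (hQ.trans (by norm_num))
  have hPc := hP.isClosed_range hC
  have hQc := hQb.isClosed_range (by linarith)
  refine le_antisymm (mk_coker_le_mk_coker hQc hPc hP (by linarith))
    (mk_coker_le_mk_coker hPc hQc hQb ?_)
  rw [norm_sub_rev]
  linarith

end CardinalOfKernel

section Constancy

open Cardinal

/-- A cardinal-valued function on a preconnected space is constant if its finite thresholds are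
open conditions and its infinite values agree with a locally constant function. -/
theorem eq_of_eventually_thresholds {ι : Type*} [TopologicalSpace ι] [PreconnectedSpace ι]
    {r c : ι → Cardinal} (hle : ∀ i (n : ℕ), n ≤ r i → ∀ᶠ j in 𝓝 i, n ≤ r j)
    (hge : ∀ i (n : ℕ), r i ≤ n → ∀ᶠ j in 𝓝 i, r j ≤ n)
    (hc : ∀ i, ∀ᶠ j in 𝓝 i, c j = c i) (hrc : ∀ i, ℵ₀ ≤ r i → r i = c i) (i j : ι) :
    r i = r j := by
  have hn : ∀ n : ℕ, ((n : Cardinal) ≤ r i) = ((n : Cardinal) ≤ r j) := by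
    intro n
    refine IsLocallyConstant.apply_eq_of_preconnectedSpace (f := fun k => (n : Cardinal) ≤ r k)
      ((IsLocallyConstant.iff_eventually_eq _).2 fun k => ?_) i j
    by_cases hk : (n : Cardinal) ≤ r k
    · filter_upwards [hle k n hk] with l hl
      exact propext ⟨fun _ => hk, fun _ => hl⟩
    · have hlt := not_le.1 hk
      obtain ⟨m, hm⟩ := Cardinal.lt_aleph0.1 (hlt.trans natCast_lt_aleph0)
      filter_upwards [hge k m hm.le] with l hl
      rw [hm] at hlt
      exact propext ⟨fun h => absurd (h.trans hl) (not_le.2 hlt), fun h => absurd h hk⟩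
  rcases lt_or_ge (r i) ℵ₀ with hi | hi
  · obtain ⟨m, hm⟩ := Cardinal.lt_aleph0.1 hi
    refine le_antisymm (hm ▸ (hn m).mp hm.ge) (le_of_not_gt fun h => ?_)
    rw [hm] at h
    have h2 : ((m + 1 : ℕ) : Cardinal) ≤ r j := by
      rcases lt_or_ge (r j) ℵ₀ with hj | hj
      · obtain ⟨k, hk⟩ := Cardinal.lt_aleph0.1 hj
        rw [hk, Nat.cast_lt] at h
        rw [hk, Nat.cast_le]
        exact h
      · exact natCast_le_aleph0.trans hj
    rw [← hn, hm, Nat.cast_le] at h2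
    omega
  · have hj : ℵ₀ ≤ r j := aleph0_le.2 fun n => (hn n).mp (natCast_le_aleph0.trans hi)
    rw [hrc i hi, hrc j hj]
    exact IsLocallyConstant.apply_eq_of_preconnectedSpace
      ((IsLocallyConstant.iff_eventually_eq _).2 hc) i j

variable {ι : Type*} [TopologicalSpace ι] [PreconnectedSpace ι] [CompleteSpace E] [CompleteSpace F]

theorem rank_ker_eq_of_surjective {P : ι → E →L[ℂ] F} (hPc : Continuous P)
    (hP : ∀ i, Function.Surjective (P i)) (i j : ι) :
    Module.rank ℂ (P i).ker = Module.rank ℂ (P j).ker := by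
  refine eq_of_eventually_thresholds (r := fun i => Module.rank ℂ (P i).ker)
    (c := fun i => #(P i).ker)
    (fun k n h => (hPc.tendsto k).eventually (eventually_le_rank_ker (hP k) h))
    (fun k n h => (hPc.tendsto k).eventually (eventually_rank_ker_le (hP k) h))
    (fun k => ?_) (fun k hk => ?_) i j
  · obtain ⟨C, hC, h⟩ := exists_surjectiveWith (hP k)
    exact (hPc.tendsto k).eventually (eventually_mk_ker_eq hC h)
  · have : CompleteSpace (P k).ker := (P k).isClosed_ker.completeSpace_coe
    exact rank_eq_mk_of_aleph0_le_rank hk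

theorem rank_coker_eq_of_boundedBelow {P : ι → E →L[ℂ] F} (hPc : Continuous P)
    (hP : ∀ i, ∃ C, 0 ≤ C ∧ BoundedBelowWith (P i) C) (i j : ι) :
    Module.rank ℂ (F ⧸ (P i).range) = Module.rank ℂ (F ⧸ (P j).range) := by
  choose C hC hb using hP
  refine eq_of_eventually_thresholds (r := fun i => Module.rank ℂ (F ⧸ (P i).range))
    (c := fun i => #(F ⧸ (P i).range))
    (fun k n h => (hPc.tendsto k).eventually (eventually_le_rank_coker (hC k) (hb k) h))
    (fun k n h => (hPc.tendsto k).eventually (eventually_rank_coker_le (hC k) (hb k) h))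
    (fun k => (hPc.tendsto k).eventually (eventually_mk_coker_eq (hC k) (hb k)))
    (fun k hk => ?_) i j
  have := (hb k).isClosed_range (hC k)
  exact rank_eq_mk_of_aleph0_le_rank hk

end Constancy

end Perturbation

section PreimageChain

variable {Z W : Type*} [AddCommGroup Z] [Module ℂ Z] [AddCommGroup W] [Module ℂ W]

/-- The decreasing sequence `M₀ = Z`, `Mₙ₊₁ = S⁻¹(T(Mₙ))` attached to two linear maps. -/
def preimageChain (T S : Z →ₗ[ℂ] W) : ℕ → Submodule ℂ Z
  | 0 => ⊤
  | n + 1 => ((preimageChain T S n).map T).comap S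

theorem exists_mem_iInf_preimageChain {T S : Z →ₗ[ℂ] W}
    (h : ∀ n, T.ker ≤ preimageChain T S n) {x : Z} (hx : x ∈ ⨅ n, preimageChain T S n) :
    ∃ u ∈ ⨅ n, preimageChain T S n, T u = S x := by
  rw [Submodule.mem_iInf] at hx
  have hv : ∀ n, ∃ v ∈ preimageChain T S n, T v = S x := fun n => hx (n + 1)
  choose v hv hTv using hv
  refine ⟨v 0, (Submodule.mem_iInf _).2 fun n => ?_, hTv 0⟩
  have hd : v 0 - v n ∈ preimageChain T S n :=
    h n (by rw [LinearMap.mem_ker, map_sub, hTv, hTv, sub_self])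
  simpa using add_mem hd (hv n)

theorem ker_sub_smul_le_preimageChain {T S : Z →ₗ[ℂ] W}
    (h : ∀ n, T.ker ≤ preimageChain T S n) (μ : ℂ) (n : ℕ) :
    (T - μ • S).ker ≤ preimageChain T S n := by
  rcases eq_or_ne μ 0 with rfl | hμ
  · simpa using h n
  induction n with
  | zero => exact le_top
  | succ n ih =>
    intro x hx
    refine ⟨μ⁻¹ • x, Submodule.smul_mem _ _ (ih hx), ?_⟩
    rw [LinearMap.mem_ker, LinearMap.sub_apply, LinearMap.smul_apply, sub_eq_zero] at hx
    rw [map_smul, hx, inv_smul_smul₀ hμ]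

end PreimageChain

section Reduction

variable {Z W : Type*} [NormedAddCommGroup Z] [NormedSpace ℂ Z] [NormedAddCommGroup W]
  [NormedSpace ℂ W]

/-- Every vector can be moved along `ker T` so that it is bounded by `c ‖T z‖` while its image
under `S` is bounded by `q ‖T z‖`. -/
def BoundedModKer (T S : Z →L[ℂ] W) (c q : ℝ) : Prop :=
  ∀ z, ∃ k, T k = 0 ∧ ‖z - k‖ ≤ c * ‖T z‖ ∧ ‖S (z - k)‖ ≤ q * ‖T z‖

variable {T S : Z →L[ℂ] W} {c q : ℝ}

theorem BoundedModKer.isClosed_map [CompleteSpace Z] (H : BoundedModKer T S c q)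
    {M : Submodule ℂ Z} (hM : IsClosed (M : Set Z)) (hker : T.ker ≤ M) :
    IsClosed ((M.map (T : Z →ₗ[ℂ] W) : Submodule ℂ W) : Set W) := by
  have : CompleteSpace M := hM.completeSpace_coe
  let f : NormedAddGroupHom M W :=
    { toFun := fun m => T m
      map_add' := fun a b => by simp
      bound' := ⟨‖T‖, fun m => T.le_opNorm m⟩ }
  have hf : f.SurjectiveOnWith (M.map (T : Z →ₗ[ℂ] W)).toAddSubgroup c := by
    rintro _ ⟨m, hm, rfl⟩
    obtain ⟨k, hk, h1, -⟩ := H m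
    refine ⟨⟨m - k, M.sub_mem hm (hker hk)⟩, ?_, h1⟩
    change T (m - k) = T m
    rw [map_sub, hk, sub_zero]
  obtain ⟨C, hC, hf⟩ := hf.exists_pos
  have h := controlled_closure_of_complete hC one_pos hf
  refine isClosed_of_closure_subset fun w hw => ?_
  obtain ⟨m, hm, -⟩ := h w hw
  exact ⟨m, m.2, hm⟩

/-- The restriction of `T - μ S` to `M`, with values in `T(M)`. -/
def restrictPencil (T S : Z →L[ℂ] W) (M : Submodule ℂ Z)
    (hS : ∀ x ∈ M, S x ∈ M.map (T : Z →ₗ[ℂ] W)) (μ : ℂ) :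
    M →L[ℂ] (M.map (T : Z →ₗ[ℂ] W) : Submodule ℂ W) :=
  (T ∘L M.subtypeL).codRestrict (M.map (T : Z →ₗ[ℂ] W)) (fun x => ⟨x, x.2, rfl⟩) -
    μ • (S ∘L M.subtypeL).codRestrict (M.map (T : Z →ₗ[ℂ] W)) (fun x => hS x x.2)

/-- The map `Z ⧸ M → W ⧸ T(M)` induced by `T - μ S`. -/
def quotientPencil (T S : Z →L[ℂ] W) (M : Submodule ℂ Z)
    (hS : ∀ x ∈ M, S x ∈ M.map (T : Z →ₗ[ℂ] W)) (μ : ℂ) :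
    (Z ⧸ M) →L[ℂ] W ⧸ (M.map (T : Z →ₗ[ℂ] W)) :=
  M.liftQL ((M.map (T : Z →ₗ[ℂ] W)).mkQL ∘L T)
      (fun x hx => (Submodule.Quotient.mk_eq_zero _).2 ⟨x, hx, rfl⟩) -
    μ • M.liftQL ((M.map (T : Z →ₗ[ℂ] W)).mkQL ∘L S)
      (fun x hx => (Submodule.Quotient.mk_eq_zero _).2 (hS x hx))

variable {M : Submodule ℂ Z} {hS : ∀ x ∈ M, S x ∈ M.map (T : Z →ₗ[ℂ] W)}

theorem quotientPencil_mk (μ : ℂ) (z : Z) :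
    quotientPencil T S M hS μ (M.mkQ z) = (M.map (T : Z →ₗ[ℂ] W)).mkQ (T z - μ • S z) := rfl

theorem BoundedModKer.surjective_restrictPencil [CompleteSpace Z] (H : BoundedModKer T S c q)
    (hc : 0 ≤ c) (hq : 0 ≤ q) (hM : IsClosed (M : Set Z)) (hker : T.ker ≤ M) {μ : ℂ}
    (hμ : ‖μ‖ * q < 1) : Function.Surjective (restrictPencil T S M hS μ) := by
  have : CompleteSpace M := hM.completeSpace_coe
  intro y
  refine (exists_preimage_of_approx (restrictPencil T S M hS μ) hc
    (mul_nonneg (norm_nonneg μ) hq) hμ ?_ y).imp fun x hx => hx.1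
  rintro ⟨_, m, hm, rfl⟩
  obtain ⟨k, hk, h1, h2⟩ := H m
  refine ⟨⟨m - k, M.sub_mem hm (hker hk)⟩, h1, ?_⟩
  change ‖T m - (T (m - k) - μ • S (m - k))‖ ≤ ‖μ‖ * q * ‖T m‖
  rw [map_sub T, hk, sub_zero, sub_sub_cancel, norm_smul, mul_assoc]
  exact mul_le_mul_of_nonneg_left h2 (norm_nonneg μ)

theorem BoundedModKer.boundedBelowWith_quotientPencil (H : BoundedModKer T S c q)
    (hc : 0 ≤ c) (hq : 0 ≤ q) [IsClosed (M : Set Z)]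
    [IsClosed ((M.map (T : Z →ₗ[ℂ] W) : Submodule ℂ W) : Set W)] (hker : T.ker ≤ M) {μ : ℂ}
    (hμ : ‖μ‖ * q < 1) :
    BoundedBelowWith (quotientPencil T S M hS μ) (c / (1 - ‖μ‖ * q)) := by
  intro ζ
  set N := M.map (T : Z →ₗ[ℂ] W)
  obtain ⟨z, rfl⟩ := M.mkQ_surjective ζ
  set t := ‖N.mkQ (T z)‖ with ht
  have key : ∀ ε > 0, ∃ z', M.mkQ z' = M.mkQ z ∧ ‖z'‖ ≤ c * (t + ε) ∧ ‖S z'‖ ≤ q * (t + ε) := by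
    intro ε hε
    obtain ⟨w, hw, hwn⟩ := Submodule.Quotient.norm_mk_lt (S := N) (N.mkQ (T z)) hε
    obtain ⟨m, hm, hmw⟩ := (Submodule.Quotient.eq N).1 hw
    obtain ⟨k, hk, h1, h2⟩ := H (z + m)
    have hTz : T (z + m) = w := by
      rw [map_add]
      change T m = w - T z at hmw
      rw [hmw]; abel
    rw [hTz] at h1 h2
    refine ⟨z + m - k, (Submodule.Quotient.eq M).2 ?_, h1.trans ?_, h2.trans ?_⟩
    · rw [add_sub_assoc, add_sub_cancel_left]
      exact M.sub_mem hm (hker hk)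
    · gcongr
    · gcongr
  have hz : ‖M.mkQ z‖ ≤ c * t := by
    refine le_of_forall_pos_le_add fun δ hδ => ?_
    obtain ⟨z', h1, h2, -⟩ := key (δ / (c + 1)) (by positivity)
    have h3 : ‖M.mkQ z'‖ ≤ ‖z'‖ := Submodule.Quotient.norm_mk_le _ _
    rw [h1] at h3
    have h4 : c * (δ / (c + 1)) ≤ δ := by
      rw [mul_div_assoc', div_le_iff₀ (by positivity)]
      nlinarith
    linarith
  have hSz : ‖N.mkQ (S z)‖ ≤ q * t := by
    refine le_of_forall_pos_le_add fun δ hδ => ?_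
    obtain ⟨z', h1, -, h2⟩ := key (δ / (q + 1)) (by positivity)
    have h3 : ‖N.mkQ (S z')‖ ≤ ‖S z'‖ := Submodule.Quotient.norm_mk_le _ _
    have h5 : N.mkQ (S z') = N.mkQ (S z) := by
      refine (Submodule.Quotient.eq N).2 ?_
      rw [← map_sub]
      exact hS _ ((Submodule.Quotient.eq M).1 h1)
    rw [h5] at h3
    have h4 : q * (δ / (q + 1)) ≤ δ := by
      rw [mul_div_assoc', div_le_iff₀ (by positivity)]
      nlinarith
    linarith
  have hP : (1 - ‖μ‖ * q) * t ≤ ‖quotientPencil T S M hS μ (M.mkQ z)‖ := by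
    rw [quotientPencil_mk, map_sub, map_smul]
    have h1 := norm_sub_norm_le (N.mkQ (T z)) (μ • N.mkQ (S z))
    rw [norm_smul] at h1
    have h2 := mul_le_mul_of_nonneg_left hSz (norm_nonneg μ)
    linarith
  have hpos : 0 < 1 - ‖μ‖ * q := by linarith
  rw [div_mul_eq_mul_div, le_div_iff₀ hpos]
  nlinarith [mul_le_mul_of_nonneg_left hP hc]

theorem rank_ker_restrictPencil {μ : ℂ} (hμ : (T - μ • S).ker ≤ M) :
    Module.rank ℂ (restrictPencil T S M hS μ).ker = Module.rank ℂ (T - μ • S).ker := by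
  rw [← (Submodule.comapSubtypeEquivOfLe hμ).rank_eq]
  have h : (restrictPencil T S M hS μ).ker = (T - μ • S).ker.comap M.subtype := by
    ext x
    exact Subtype.ext_iff
  rw [h]

theorem rank_coker_quotientPencil {μ : ℂ}
    (hμ : Function.Surjective (restrictPencil T S M hS μ)) :
    Module.rank ℂ ((W ⧸ M.map (T : Z →ₗ[ℂ] W)) ⧸ (quotientPencil T S M hS μ).range) =
      Module.rank ℂ (W ⧸ (T - μ • S).range) := by
  have hle : M.map (T : Z →ₗ[ℂ] W) ≤ (T - μ • S).range := by
    intro w hw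
    obtain ⟨x, hx⟩ := hμ ⟨w, hw⟩
    exact ⟨x, congrArg Subtype.val hx⟩
  rw [← (Submodule.quotientQuotientEquivQuotient _ _ hle).rank_eq]
  have h : (quotientPencil T S M hS μ).range =
      (T - μ • S).range.map (M.map (T : Z →ₗ[ℂ] W)).mkQ := by
    ext w
    constructor
    · rintro ⟨ζ, rfl⟩
      obtain ⟨z, rfl⟩ := M.mkQ_surjective ζ
      exact ⟨_, ⟨z, rfl⟩, rfl⟩
    · rintro ⟨_, ⟨z, rfl⟩, rfl⟩
      exact ⟨M.mkQ z, rfl⟩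
  rw [h]

theorem BoundedModKer.rank_eq [CompleteSpace Z] [CompleteSpace W] (H : BoundedModKer T S c q)
    (hc : 0 ≤ c) (hq : 0 ≤ q)
    (hν : ∀ n, T.ker ≤ preimageChain (T : Z →ₗ[ℂ] W) S n) {μ : ℂ} (hμ : ‖μ‖ * q < 1) :
    Module.rank ℂ (T - μ • S).ker = Module.rank ℂ T.ker ∧
      Module.rank ℂ (W ⧸ (T - μ • S).range) = Module.rank ℂ (W ⧸ T.range) := by
  set I := ⨅ n, preimageChain (T : Z →ₗ[ℂ] W) S n
  set M := I.topologicalClosure with hMdef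
  have hIM : I ≤ M := I.le_topologicalClosure
  have hM : IsClosed (M : Set Z) := I.isClosed_topologicalClosure
  have hker : T.ker ≤ M := (le_iInf hν).trans hIM
  have hkerμ : ∀ ν : ℂ, (T - ν • S).ker ≤ M := fun ν =>
    (le_iInf fun n => ker_sub_smul_le_preimageChain hν ν n).trans hIM
  have hTM := H.isClosed_map hM hker
  have hS : ∀ x ∈ M, S x ∈ M.map (T : Z →ₗ[ℂ] W) := by
    have h : closure (I : Set Z) ⊆ S ⁻¹' (M.map (T : Z →ₗ[ℂ] W) : Submodule ℂ W) := by
      refine closure_minimal (fun x hx => ?_) (hTM.preimage S.continuous)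
      obtain ⟨u, hu, hux⟩ := exists_mem_iInf_preimageChain hν hx
      exact ⟨u, hIM hu, hux⟩
    exact h
  have : CompleteSpace M := hM.completeSpace_coe
  have : CompleteSpace (M.map (T : Z →ₗ[ℂ] W)) := hTM.completeSpace_coe
  have hbd : ∀ s : unitInterval, ‖((s : ℝ) : ℂ) * μ‖ * q < 1 := by
    intro s
    rw [norm_mul, Complex.norm_real, Real.norm_of_nonneg s.2.1, mul_assoc]
    exact (mul_le_of_le_one_left (by positivity) s.2.2).trans_lt hμ
  have hsurj : ∀ s : unitInterval,
      Function.Surjective (restrictPencil T S M hS (((s : ℝ) : ℂ) * μ)) := fun s =>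
    H.surjective_restrictPencil hc hq hM hker (hbd s)
  have h1 : (((1 : unitInterval) : ℝ) : ℂ) * μ = μ := by simp
  have h0 : T - ((((0 : unitInterval) : ℝ) : ℂ) * μ) • S = T := by simp
  constructor
  · have h := rank_ker_eq_of_surjective
      (P := fun s : unitInterval => restrictPencil T S M hS (((s : ℝ) : ℂ) * μ))
      (by unfold restrictPencil; fun_prop) hsurj 1 0
    simp only [rank_ker_restrictPencil (hkerμ _)] at h
    rwa [h1, h0] at h
  · have h := rank_coker_eq_of_boundedBelow
      (P := fun s : unitInterval => quotientPencil T S M hS (((s : ℝ) : ℂ) * μ))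
      (by unfold quotientPencil; fun_prop)
      (fun s => ⟨_, div_nonneg hc (by linarith [hbd s]),
        H.boundedBelowWith_quotientPencil hc hq hker (hbd s)⟩) 1 0
    simp only [rank_coker_quotientPencil (hsurj _)] at h
    rwa [h1, h0] at h

end Reduction

section LinearRelation

variable {X Y : Type*} [AddCommGroup X] [Module ℂ X] [AddCommGroup Y] [Module ℂ Y]

/-- The submodule `A(0)` of a linear relation. -/
def relMul0S (A : Submodule ℂ (X × Y)) : Submodule ℂ Y := A.comap (LinearMap.inr ℂ X Y)

/-- The graph of the operator from `X` to `Y ⧸ A(0)` induced by a linear relation. -/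
def relQuot (A : Submodule ℂ (X × Y)) : Submodule ℂ (X × (Y ⧸ relMul0S A)) :=
  A.map (LinearMap.id.prodMap (relMul0S A).mkQ)

variable {A B : Submodule ℂ (X × Y)}

theorem mk_mem_relQuot {x : X} {y : Y} : (x, (relMul0S A).mkQ y) ∈ relQuot A ↔ (x, y) ∈ A := by
  constructor
  · rintro ⟨⟨x', y'⟩, h, heq⟩
    obtain ⟨rfl, hy⟩ := Prod.mk.inj heq
    have h0 : (0, y' - y) ∈ A := (Submodule.Quotient.eq _).1 hy
    simpa using A.sub_mem h h0
  · exact fun h => ⟨(x, y), h, rfl⟩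

theorem exists_of_mem_relQuot {p : X × (Y ⧸ relMul0S A)} (hp : p ∈ relQuot A) :
    ∃ y, (p.1, y) ∈ A ∧ (relMul0S A).mkQ y = p.2 := by
  obtain ⟨⟨x, y⟩, h, rfl⟩ := hp
  exact ⟨y, h, rfl⟩

theorem fst_relQuot_injective :
    Function.Injective (LinearMap.fst ℂ X (Y ⧸ relMul0S A) ∘ₗ (relQuot A).subtype) := by
  refine (injective_iff_map_eq_zero _).2 fun p hp => ?_
  obtain ⟨y, hy, hyp⟩ := exists_of_mem_relQuot p.2
  change p.1.1 = 0 at hp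
  rw [hp] at hy
  refine Subtype.ext (Prod.ext hp ?_)
  rw [← hyp]
  exact (Submodule.Quotient.mk_eq_zero _).2 hy

theorem exists_linearMap_relQuot (hdom : relDom A ⊆ relDom B) (h0 : relMul0 B ⊆ relMul0 A) :
    ∃ S : relQuot A →ₗ[ℂ] Y ⧸ relMul0S A,
      ∀ (p : relQuot A) (z : Y), (p.1.1, z) ∈ B → S p = (relMul0S A).mkQ z := by
  have hex : ∀ p : relQuot A, ∃ z, (p.1.1, z) ∈ B := fun p =>
    let ⟨y, hy, _⟩ := exists_of_mem_relQuot p.2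
    hdom ⟨y, hy⟩
  have huniq : ∀ {x z z'}, (x, z) ∈ B → (x, z') ∈ B →
      (relMul0S A).mkQ z = (relMul0S A).mkQ z' := fun {x z z'} hz hz' =>
    (Submodule.Quotient.eq _).2 (h0 (by simpa using B.sub_mem hz hz' : (0, z - z') ∈ B))
  choose s hs using hex
  exact ⟨{ toFun := fun p => (relMul0S A).mkQ (s p)
           map_add' := fun p p' => by
             rw [← map_add]
             exact huniq (hs (p + p')) (B.add_mem (hs p) (hs p'))
           map_smul' := fun c p => by
             rw [RingHom.id_apply, ← map_smul]
             exact huniq (hs (c • p)) (B.smul_mem c (hs p)) },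
    fun p z hz => huniq (hs p) hz⟩

theorem relKerS_subRel_zero (hdom : relDom A ⊆ relDom B) : relKerS (subRel 0 A B) = relKerS A := by
  ext x
  constructor
  · rintro ⟨y, z, hy, -, h⟩
    have h : 0 = y := by simpa using h
    rw [← h] at hy
    exact hy
  · intro hx
    obtain ⟨z, hz⟩ := hdom ⟨0, hx⟩
    exact ⟨0, z, hx, hz, by simp⟩

theorem relRanS_subRel_zero (hdom : relDom A ⊆ relDom B) : relRanS (subRel 0 A B) = relRanS A := by
  ext w
  constructor
  · rintro ⟨⟨x, w⟩, ⟨y, z, hy, -, h⟩, rfl⟩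
    have h : w = y := by simpa using h
    exact ⟨(x, y), hy, h.symm⟩
  · rintro ⟨⟨x, y⟩, hy, rfl⟩
    obtain ⟨z, hz⟩ := hdom ⟨y, hy⟩
    exact ⟨(x, y), ⟨y, z, hy, hz, by simp⟩, rfl⟩

section Pencil

variable {S : relQuot A →ₗ[ℂ] Y ⧸ relMul0S A}

/-- The operator part of a linear relation. -/
def relOp (A : Submodule ℂ (X × Y)) : relQuot A →ₗ[ℂ] Y ⧸ relMul0S A :=
  LinearMap.snd ℂ X (Y ⧸ relMul0S A) ∘ₗ (relQuot A).subtype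

theorem mem_preimageChain_of_mem_Mseq
    (hS : ∀ (p : relQuot A) (z : Y), (p.1.1, z) ∈ B → S p = (relMul0S A).mkQ z) (n : ℕ) :
    ∀ p : relQuot A, p.1.1 ∈ Mseq A B n → p ∈ preimageChain (relOp A) S n := by
  induction n with
  | zero => exact fun _ _ => Submodule.mem_top
  | succ n ih =>
    rintro p ⟨y, ⟨x, hx, hxy⟩, hy⟩
    exact ⟨⟨(x, (relMul0S A).mkQ y), mk_mem_relQuot.2 hxy⟩, ih _ hx, (hS p y hy).symm⟩

theorem ker_relOp_le_preimageChain
    (hS : ∀ (p : relQuot A) (z : Y), (p.1.1, z) ∈ B → S p = (relMul0S A).mkQ z)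
    (hν : ∀ n : ℕ, relKer A ⊆ Mseq A B n) (n : ℕ) :
    (relOp A).ker ≤ preimageChain (relOp A) S n := by
  intro p hp
  refine mem_preimageChain_of_mem_Mseq hS n p (hν n (mk_mem_relQuot.1 ?_))
  have h : p.1 = (p.1.1, (relMul0S A).mkQ 0) := Prod.ext rfl hp
  exact h ▸ p.2

theorem relKerS_subRel_eq_map (hdom : relDom A ⊆ relDom B)
    (hS : ∀ (p : relQuot A) (z : Y), (p.1.1, z) ∈ B → S p = (relMul0S A).mkQ z) (μ : ℂ) :
    relKerS (subRel μ A B) = (relOp A - μ • S).ker.map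
      (LinearMap.fst ℂ X (Y ⧸ relMul0S A) ∘ₗ (relQuot A).subtype) := by
  ext x
  constructor
  · rintro ⟨y, z, hy, hz, h⟩
    have h : 0 = y - μ • z := h
    let p : relQuot A := ⟨(x, (relMul0S A).mkQ y), mk_mem_relQuot.2 hy⟩
    refine ⟨p, ?_, rfl⟩
    change (relMul0S A).mkQ y - μ • S p = 0
    rw [hS p z hz, ← map_smul, ← map_sub, ← h, map_zero]
  · rintro ⟨p, hp, rfl⟩
    obtain ⟨y, hy, hyp⟩ := exists_of_mem_relQuot p.2
    obtain ⟨z, hz⟩ := hdom ⟨y, hy⟩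
    have hp : p.1.2 - μ • S p = 0 := hp
    rw [hS p z hz, ← hyp, ← map_smul, ← map_sub] at hp
    have h0 : (0, y - μ • z) ∈ A := (Submodule.Quotient.mk_eq_zero (relMul0S A)).1 hp
    exact ⟨μ • z, z, by simpa using A.sub_mem hy h0, hz, by simp⟩

theorem rank_relKerS_subRel_congr (hdom : relDom A ⊆ relDom B)
    (hS : ∀ (p : relQuot A) (z : Y), (p.1.1, z) ∈ B → S p = (relMul0S A).mkQ z) {μ ν : ℂ}
    (h : Module.rank ℂ (relOp A - μ • S).ker = Module.rank ℂ (relOp A - ν • S).ker) :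
    Module.rank ℂ (relKerS (subRel μ A B)) = Module.rank ℂ (relKerS (subRel ν A B)) := by
  have e := fun κ : ℂ => (Submodule.equivMapOfInjective _ fst_relQuot_injective
    (relOp A - κ • S).ker).lift_rank_eq
  rw [relKerS_subRel_eq_map hdom hS, relKerS_subRel_eq_map hdom hS]
  exact Cardinal.lift_injective ((e μ).symm.trans ((congrArg _ h).trans (e ν)))

theorem map_relRanS_subRel (hdom : relDom A ⊆ relDom B)
    (hS : ∀ (p : relQuot A) (z : Y), (p.1.1, z) ∈ B → S p = (relMul0S A).mkQ z) (μ : ℂ) :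
    (relRanS (subRel μ A B)).map (relMul0S A).mkQ = (relOp A - μ • S).range := by
  ext w
  constructor
  · rintro ⟨_, ⟨⟨x, _⟩, ⟨y, z, hy, hz, rfl⟩, rfl⟩, rfl⟩
    let p : relQuot A := ⟨(x, (relMul0S A).mkQ y), mk_mem_relQuot.2 hy⟩
    refine ⟨p, ?_⟩
    change (relMul0S A).mkQ y - μ • S p = (relMul0S A).mkQ (y - μ • z)
    rw [hS p z hz, ← map_smul, ← map_sub]
  · rintro ⟨p, rfl⟩
    obtain ⟨y, hy, hyp⟩ := exists_of_mem_relQuot p.2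
    obtain ⟨z, hz⟩ := hdom ⟨y, hy⟩
    refine ⟨y - μ • z, ⟨(p.1.1, y - μ • z), ⟨y, z, hy, hz, rfl⟩, rfl⟩, ?_⟩
    change _ = p.1.2 - μ • S p
    rw [hS p z hz, ← hyp, ← map_smul, ← map_sub]

theorem rank_coker_subRel (hdom : relDom A ⊆ relDom B)
    (hS : ∀ (p : relQuot A) (z : Y), (p.1.1, z) ∈ B → S p = (relMul0S A).mkQ z) (μ : ℂ) :
    Module.rank ℂ (Y ⧸ relRanS (subRel μ A B)) =
      Module.rank ℂ ((Y ⧸ relMul0S A) ⧸ (relOp A - μ • S).range) := by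
  have hle : relMul0S A ≤ relRanS (subRel μ A B) := fun y hy =>
    ⟨(0, y), ⟨y, 0, hy, B.zero_mem, by simp⟩, rfl⟩
  rw [← map_relRanS_subRel hdom hS, (Submodule.quotientQuotientEquivQuotient _ _ hle).rank_eq]

end Pencil

end LinearRelation

section NormedLinearRelation

variable {X Y : Type*} [NormedAddCommGroup X] [NormedSpace ℂ X] [NormedAddCommGroup Y]
  [NormedSpace ℂ Y] {A B : Submodule ℂ (X × Y)}

theorem isClosed_relMul0S (hA : IsClosed (A : Set (X × Y))) :
    IsClosed (relMul0S A : Set Y) :=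
  hA.preimage (by fun_prop : Continuous fun y : Y => ((0 : X), y))

theorem isClosed_relQuot (hA : IsClosed (A : Set (X × Y))) :
    IsClosed (relQuot A : Set (X × (Y ⧸ relMul0S A))) := by
  have h := (IsOpenQuotientMap.id (X := X)).prodMap (relMul0S A).isOpenQuotientMap_mkQ
  rw [← h.isQuotientMap.isClosed_preimage]
  convert hA using 1
  ext ⟨x, y⟩
  exact mk_mem_relQuot

theorem norm_mkQ_eq_infDist (N : Submodule ℂ Y) (y : Y) : ‖N.mkQ y‖ = infDist y N :=
  QuotientAddGroup.norm_mk y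

/-- The operator part of a linear relation, as a continuous linear map. -/
def relOpL (A : Submodule ℂ (X × Y)) : relQuot A →L[ℂ] Y ⧸ relMul0S A :=
  ContinuousLinearMap.snd ℂ X (Y ⧸ relMul0S A) ∘L (relQuot A).subtypeL

theorem norm_le_of_relBounded [IsClosed (relMul0S A : Set Y)] (hdom : relDom A ⊆ relDom B)
    (h0 : relMul0 B ⊆ relMul0 A) {σ τ : ℝ}
    (hrb : ∀ x y, (x, y) ∈ A → ∀ z, (x, z) ∈ B →
      infDist z (closure (relMul0 B)) ≤ σ * ‖x‖ + τ * infDist y (closure (relMul0 A)))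
    {S : relQuot A →ₗ[ℂ] Y ⧸ relMul0S A}
    (hS : ∀ (p : relQuot A) (z : Y), (p.1.1, z) ∈ B → S p = (relMul0S A).mkQ z) (p : relQuot A) :
    ‖S p‖ ≤ σ * ‖p.1.1‖ + τ * ‖p.1.2‖ := by
  obtain ⟨y, hy, hyp⟩ := exists_of_mem_relQuot p.2
  obtain ⟨z, hz⟩ := hdom ⟨y, hy⟩
  have h := hrb _ y hy z hz
  rw [infDist_closure, infDist_closure] at h
  rw [hS p z hz, ← hyp, norm_mkQ_eq_infDist, norm_mkQ_eq_infDist]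
  exact (infDist_le_infDist_of_subset h0 ⟨0, B.zero_mem⟩).trans h

theorem boundedModKer_relOpL [IsClosed (relMul0S A : Set Y)] {γ γ' σ τ : ℝ} (hγ' : 0 < γ')
    (hlt : γ' < γ)
    (hlb : ∀ x y, (x, y) ∈ A → γ * infDist x (relKer A) ≤ infDist y (closure (relMul0 A)))
    (hσ : 0 ≤ σ) {S : relQuot A →L[ℂ] Y ⧸ relMul0S A}
    (hS : ∀ p : relQuot A, ‖S p‖ ≤ σ * ‖p.1.1‖ + τ * ‖p.1.2‖) :
    BoundedModKer (relOpL A) S (1 / γ' + 1) (σ / γ' + τ) := by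
  intro p
  change ∃ k : relQuot A, k.1.2 = 0 ∧ ‖p - k‖ ≤ (1 / γ' + 1) * ‖p.1.2‖ ∧
    ‖S (p - k)‖ ≤ (σ / γ' + τ) * ‖p.1.2‖
  rcases eq_or_ne p.1.2 0 with h0 | h0
  · exact ⟨p, h0, by simp [h0], by simp [h0]⟩
  obtain ⟨y, hy, hyp⟩ := exists_of_mem_relQuot p.2
  have hpos : 0 < ‖p.1.2‖ := norm_pos_iff.2 h0
  have h1 := hlb _ y hy
  have h2 : infDist y (relMul0 A) = ‖p.1.2‖ := by
    rw [← hyp, norm_mkQ_eq_infDist]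
    rfl
  rw [infDist_closure, h2] at h1
  have h3 : infDist p.1.1 (relKer A) < ‖p.1.2‖ / γ' := by
    rw [lt_div_iff₀ hγ']
    rcases (infDist_nonneg (x := p.1.1) (s := relKer A)).eq_or_lt with h | h
    · rwa [← h, zero_mul]
    · nlinarith
  obtain ⟨k, hk, hkd⟩ := (infDist_lt_iff (s := relKer A) ⟨0, A.zero_mem⟩).1 h3
  rw [dist_eq_norm] at hkd
  have hk0 : (k, (relMul0S A).mkQ 0) ∈ relQuot A := mk_mem_relQuot.2 hk
  set κ : relQuot A := ⟨_, hk0⟩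
  have hκ : κ.1.2 = 0 := map_zero _
  have hsnd : (p - κ).1.2 = p.1.2 := by
    change p.1.2 - κ.1.2 = _
    rw [hκ, sub_zero]
  have hfst : ‖(p - κ).1.1‖ ≤ 1 / γ' * ‖p.1.2‖ := by
    rw [one_div_mul_eq_div]
    exact hkd.le
  refine ⟨κ, hκ, ?_, (hS _).trans ?_⟩
  · change max ‖(p - κ).1.1‖ ‖(p - κ).1.2‖ ≤ _
    rw [hsnd, add_mul, one_mul]
    have : 0 ≤ 1 / γ' * ‖p.1.2‖ := by positivity
    exact max_le (by linarith) (by linarith)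
  · rw [hsnd, add_mul, div_eq_mul_one_div σ, mul_assoc]
    gcongr

theorem rank_subRel_eq [CompleteSpace X] [CompleteSpace Y]
    (hA : IsClosed (A : Set (X × Y))) {γ : ℝ}
    (hlb : ∀ x y, (x, y) ∈ A → γ * infDist x (relKer A) ≤ infDist y (closure (relMul0 A)))
    (hdom : relDom A ⊆ relDom B) (h0 : relMul0 B ⊆ relMul0 A)
    {σ τ : ℝ} (hσ : 0 ≤ σ) (hτ : 0 ≤ τ)
    (hrb : ∀ x y, (x, y) ∈ A → ∀ z, (x, z) ∈ B →
      infDist z (closure (relMul0 B)) ≤ σ * ‖x‖ + τ * infDist y (closure (relMul0 A)))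
    (hν : ∀ n : ℕ, relKer A ⊆ Mseq A B n) {μ : ℂ} (hμ : ‖μ‖ * (σ + τ * γ) < γ) (hγ : 0 < γ) :
    Module.rank ℂ (relKerS (subRel μ A B)) = Module.rank ℂ (relKerS A) ∧
      Module.rank ℂ (Y ⧸ relRanS (subRel μ A B)) = Module.rank ℂ (Y ⧸ relRanS A) := by
  have : IsClosed (relMul0S A : Set Y) := isClosed_relMul0S hA
  have : CompleteSpace (relQuot A) := (isClosed_relQuot hA).completeSpace_coe
  obtain ⟨S, hS⟩ := exists_linearMap_relQuot hdom h0
  have hSb := norm_le_of_relBounded hdom h0 hrb hS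
  let SL : relQuot A →L[ℂ] Y ⧸ relMul0S A := S.mkContinuous (σ + τ) fun p => by
    refine (hSb p).trans ?_
    rw [add_mul]
    gcongr
    · exact norm_fst_le p.1
    · exact norm_snd_le p.1
  obtain ⟨γ', hγ'0, hγ'γ, hγ'⟩ : ∃ γ', 0 < γ' ∧ γ' < γ ∧ ‖μ‖ * (σ + τ * γ') < γ' := by
    have h1 : 0 ≤ ‖μ‖ * (σ + τ * γ) := by positivity
    have h2 : 0 ≤ ‖μ‖ * τ := by positivity
    refine ⟨γ - (γ - ‖μ‖ * (σ + τ * γ)) / 2, by linarith, by linarith, ?_⟩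
    nlinarith
  have H := boundedModKer_relOpL hγ'0 hγ'γ hlb hσ (S := SL) hSb
  have hq : ‖μ‖ * (σ / γ' + τ) < 1 := by
    have h : ‖μ‖ * (σ / γ' + τ) = ‖μ‖ * (σ + τ * γ') / γ' := by field_simp
    rwa [h, div_lt_one hγ'0]
  obtain ⟨hk, hc⟩ := H.rank_eq (by positivity) (by positivity)
    (ker_relOp_le_preimageChain hS hν) hq
  have hk' : Module.rank ℂ (relOp A - μ • S).ker =
      Module.rank ℂ (relOp A - (0 : ℂ) • S).ker := by rw [zero_smul, sub_zero]; exact hk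
  have hc' : Module.rank ℂ ((Y ⧸ relMul0S A) ⧸ (relOp A - μ • S).range) =
      Module.rank ℂ ((Y ⧸ relMul0S A) ⧸ (relOp A - (0 : ℂ) • S).range) := by
    rw [zero_smul, sub_zero]; exact hc
  rw [← relKerS_subRel_zero hdom, ← relRanS_subRel_zero hdom]
  refine ⟨rank_relKerS_subRel_congr hdom hS hk', ?_⟩
  rw [rank_coker_subRel hdom hS, rank_coker_subRel hdom hS, hc']

end NormedLinearRelation

theorem stmt19 {X Y : Type*} [NormedAddCommGroup X] [NormedSpace ℂ X] [CompleteSpace X]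
    [NormedAddCommGroup Y] [NormedSpace ℂ Y] [CompleteSpace Y]
    (A B : Submodule ℂ (X × Y))
    (hA : IsClosed (A : Set (X × Y))) (hB : IsClosed (B : Set (X × Y)))
    (hRA : IsClosed (relRan A))
    (γ : ℝ) (hγ : 0 < γ)
    (hlb : ∀ x y, (x, y) ∈ A → γ * infDist x (relKer A) ≤ infDist y (closure (relMul0 A)))
    (hdom : relDom A ⊆ relDom B) (h0 : relMul0 B ⊆ relMul0 A)
    (σ τ : ℝ) (hσ : 0 ≤ σ) (hτ : 0 ≤ τ)
    (hrb : ∀ x y, (x, y) ∈ A → ∀ z, (x, z) ∈ B →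
      infDist z (closure (relMul0 B)) ≤ σ * ‖x‖ + τ * infDist y (closure (relMul0 A)))
    (hν : ∀ n : ℕ, relKer A ⊆ Mseq A B n) :
    ∀ lam : ℂ, ‖lam‖ * (3 * σ + τ * γ) < γ →
      Module.rank ℂ ↥(relKerS (subRel lam A B)) = Module.rank ℂ ↥(relKerS A) ∧
      Module.rank ℂ (Y ⧸ relRanS (subRel lam A B)) = Module.rank ℂ (Y ⧸ relRanS A) := by
  intro lam hlam
  refine rank_subRel_eq hA hlb hdom h0 hσ hτ hrb hν (lt_of_le_of_lt ?_ hlam) hγ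
  gcongr
  linarith
end
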